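/- arXiv:2605.03113 — 3 statements merged into one kernel-verified Lean document; each statement's English description precedes it below -/
import Mathlib

section
/- Coherence theorem for unitless linearly distributive categories: the free unitless LD category on any type S is thin. Precisely, let 𝓕 be an LD category together with a function η : S → Ob(𝓕) satisfying the universal property of the free LD category on S; then for all objects X, Y of 𝓕 there is at most one morphism X → Y. -/
open CategoryTheory

namespace LDCoherence

universe v u v₁ u₁ v₂ u₂

/-- A (unitless) linearly distributive category structure on a category `C`. -/
structure LD (C : Type u) [Category.{v} C] where
  ot : C → C → C
  pa : C → C → C
  otHom : ∀ {X₁ Y₁ X₂ Y₂ : C}, (X₁ ⟶ Y₁) → (X₂ ⟶ Y₂) → (ot X₁ X₂ ⟶ ot Y₁ Y₂)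
  paHom : ∀ {X₁ Y₁ X₂ Y₂ : C}, (X₁ ⟶ Y₁) → (X₂ ⟶ Y₂) → (pa X₁ X₂ ⟶ pa Y₁ Y₂)
  otHom_id : ∀ X Y : C, otHom (𝟙 X) (𝟙 Y) = 𝟙 (ot X Y)
  otHom_comp :
    ∀ {X₁ Y₁ Z₁ X₂ Y₂ Z₂ : C} (f₁ : X₁ ⟶ Y₁) (g₁ : Y₁ ⟶ Z₁) (f₂ : X₂ ⟶ Y₂) (g₂ : Y₂ ⟶ Z₂),
      otHom (f₁ ≫ g₁) (f₂ ≫ g₂) = otHom f₁ f₂ ≫ otHom g₁ g₂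
  paHom_id : ∀ X Y : C, paHom (𝟙 X) (𝟙 Y) = 𝟙 (pa X Y)
  paHom_comp :
    ∀ {X₁ Y₁ Z₁ X₂ Y₂ Z₂ : C} (f₁ : X₁ ⟶ Y₁) (g₁ : Y₁ ⟶ Z₁) (f₂ : X₂ ⟶ Y₂) (g₂ : Y₂ ⟶ Z₂),
      paHom (f₁ ≫ g₁) (f₂ ≫ g₂) = paHom f₁ f₂ ≫ paHom g₁ g₂
  α : ∀ A B E : C, ot A (ot B E) ⟶ ot (ot A B) E
  αInv : ∀ A B E : C, ot (ot A B) E ⟶ ot A (ot B E)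
  pα : ∀ A B E : C, pa A (pa B E) ⟶ pa (pa A B) E
  pαInv : ∀ A B E : C, pa (pa A B) E ⟶ pa A (pa B E)
  δl : ∀ A B E : C, ot A (pa B E) ⟶ pa (ot A B) E
  δr : ∀ A B E : C, ot (pa A B) E ⟶ pa A (ot B E)
  α_αInv : ∀ A B E : C, α A B E ≫ αInv A B E = 𝟙 _
  αInv_α : ∀ A B E : C, αInv A B E ≫ α A B E = 𝟙 _
  pα_pαInv : ∀ A B E : C, pα A B E ≫ pαInv A B E = 𝟙 _
  pαInv_pα : ∀ A B E : C, pαInv A B E ≫ pα A B E = 𝟙 _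
  α_natural :
    ∀ {A A' B B' E E' : C} (f : A ⟶ A') (g : B ⟶ B') (h : E ⟶ E'),
      otHom f (otHom g h) ≫ α A' B' E' = α A B E ≫ otHom (otHom f g) h
  pα_natural :
    ∀ {A A' B B' E E' : C} (f : A ⟶ A') (g : B ⟶ B') (h : E ⟶ E'),
      paHom f (paHom g h) ≫ pα A' B' E' = pα A B E ≫ paHom (paHom f g) h
  δl_natural :
    ∀ {A A' B B' E E' : C} (f : A ⟶ A') (g : B ⟶ B') (h : E ⟶ E'),
      otHom f (paHom g h) ≫ δl A' B' E' = δl A B E ≫ paHom (otHom f g) h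
  δr_natural :
    ∀ {A A' B B' E E' : C} (f : A ⟶ A') (g : B ⟶ B') (h : E ⟶ E'),
      otHom (paHom f g) h ≫ δr A' B' E' = δr A B E ≫ paHom f (otHom g h)
  P1 : ∀ A B E D : C,
    α A B (ot E D) ≫ α (ot A B) E D =
      otHom (𝟙 A) (α B E D) ≫ α A (ot B E) D ≫ otHom (α A B E) (𝟙 D)
  P2 : ∀ A B E D : C,
    α A B (pa E D) ≫ δl (ot A B) E D =
      otHom (𝟙 A) (δl B E D) ≫ δl A (ot B E) D ≫ paHom (α A B E) (𝟙 D)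
  P3 : ∀ A B E D : C,
    otHom (𝟙 A) (δr B E D) ≫ δl A B (ot E D) =
      α A (pa B E) D ≫ otHom (δl A B E) (𝟙 D) ≫ δr (ot A B) E D
  P4 : ∀ A B E D : C,
    δl A B (pa E D) ≫ pα (ot A B) E D =
      otHom (𝟙 A) (pα B E D) ≫ δl A (pa B E) D ≫ paHom (δl A B E) (𝟙 D)
  P5 : ∀ A B E D : C,
    δr A B (ot E D) ≫ paHom (𝟙 A) (α B E D) =
      α (pa A B) E D ≫ otHom (δr A B E) (𝟙 D) ≫ δr A (ot B E) D
  P6 : ∀ A B E D : C,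
    δl (pa A B) E D ≫ paHom (δr A B E) (𝟙 D) =
      δr A B (pa E D) ≫ paHom (𝟙 A) (δl B E D) ≫ pα A (ot B E) D
  P7 : ∀ A B E D : C,
    otHom (pα A B E) (𝟙 D) ≫ δr (pa A B) E D =
      δr A (pa B E) D ≫ paHom (𝟙 A) (δr B E D) ≫ pα A B (ot E D)
  P8 : ∀ A B E D : C,
    pα A B (pa E D) ≫ pα (pa A B) E D =
      paHom (𝟙 A) (pα B E D) ≫ pα A (pa B E) D ≫ paHom (pα A B E) (𝟙 D)

variable {C : Type u} [Category.{v} C]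

/-- Tidiness of a linearly distributive category. -/
def LD.Tidy (L : LD C) : Prop :=
  (∀ A₁ A₂ B₁ B₂ : C, L.ot A₁ A₂ = L.ot B₁ B₂ → A₁ = B₁ ∧ A₂ = B₂) ∧
  (∀ A₁ A₂ B₁ B₂ : C, L.pa A₁ A₂ = L.pa B₁ B₂ → A₁ = B₁ ∧ A₂ = B₂) ∧
  (∀ A₁ A₂ B₁ B₂ : C, L.ot A₁ A₂ ≠ L.pa B₁ B₂)

/-- Generators of the free monoid 𝔜. -/
inductive YGen : Type
  | a : YGen
  | ainv : YGen

/-- Generators of the free monoid 𝔝. -/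
inductive ZGen : Type
  | pa : ZGen
  | painv : ZGen
  | dl : ZGen
  | dr : ZGen

/-- A word in the free monoid 𝔜 together with a matching vector of objects:
each letter carries the object of the vector that it consumes in the recursions
defining `H`, `L`, `R` and `τ`.  The outermost constructor is the terminal letter. -/
inductive YW (C : Type u) : Type u
  | nil : YW C
  | a : C → YW C → YW C
  | ainv : C → YW C → YW C

/-- The underlying word in 𝔜 of a word-with-vector. -/
def YW.word {C : Type u} : YW C → List YGen
  | .nil => []
  | .a _ w => YGen.a :: w.word
  | .ainv _ w => YGen.ainv :: w.word

/-- A word in the free monoid 𝔝 together with a matching vector of objects. -/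
inductive ZW (C : Type u) : Type u
  | nil : ZW C
  | pa : C → ZW C → ZW C
  | painv : C → ZW C → ZW C
  | dl : C → ZW C → ZW C
  | dr : C → ZW C → ZW C

/-- The underlying word in 𝔝 of a word-with-vector. -/
def ZW.word {C : Type u} : ZW C → List ZGen
  | .nil => []
  | .pa _ w => ZGen.pa :: w.word
  | .painv _ w => ZGen.painv :: w.word
  | .dl _ w => ZGen.dl :: w.word
  | .dr _ w => ZGen.dr :: w.word

/-- The functor `H^f_u` (object part), for `f` with source `X` and target an ⊗-product. -/
def Hot (L : LD C) (X : C) : YW C → C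
  | .nil => X
  | .a A w => L.ot A (Hot L X w)
  | .ainv A w => L.ot (Hot L X w) A

/-- The functor `L^f_u` (object part), for `f` with target `L.ot Y Z`. -/
def Lot (L : LD C) (Y : C) : YW C → C
  | .nil => Y
  | .a A w => L.ot A (Lot L Y w)
  | .ainv _ w => Lot L Y w

/-- The functor `R^f_u` (object part), for `f` with target `L.ot Y Z`. -/
def Rot (L : LD C) (Z : C) : YW C → C
  | .nil => Z
  | .a _ w => Rot L Z w
  | .ainv A w => L.ot (Rot L Z w) A

/-- The natural transformation `τ^f_u` (componentwise). -/
def tau (L : LD C) {X Y Z : C} (f : X ⟶ L.ot Y Z) :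
    (w : YW C) → (Hot L X w ⟶ L.ot (Lot L Y w) (Rot L Z w))
  | .nil => f
  | .a A w => L.otHom (𝟙 A) (tau L f w) ≫ L.α A (Lot L Y w) (Rot L Z w)
  | .ainv A w => L.otHom (tau L f w) (𝟙 A) ≫ L.αInv (Lot L Y w) (Rot L Z w) A

/-- The functor `H^f_u` (object part), for `f` with source `X` and target a ⅋-product. -/
def Hpa (L : LD C) (X : C) : ZW C → C
  | .nil => X
  | .pa A w => L.pa A (Hpa L X w)
  | .painv A w => L.pa (Hpa L X w) A
  | .dl A w => L.ot A (Hpa L X w)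
  | .dr A w => L.ot (Hpa L X w) A

/-- The functor `L^f_u` (object part), for `f` with target `L.pa Y Z`. -/
def Lpa (L : LD C) (Y : C) : ZW C → C
  | .nil => Y
  | .pa A w => L.pa A (Lpa L Y w)
  | .painv _ w => Lpa L Y w
  | .dl A w => L.ot A (Lpa L Y w)
  | .dr _ w => Lpa L Y w

/-- The functor `R^f_u` (object part), for `f` with target `L.pa Y Z`. -/
def Rpa (L : LD C) (Z : C) : ZW C → C
  | .nil => Z
  | .pa _ w => Rpa L Z w
  | .painv A w => L.pa (Rpa L Z w) A
  | .dl _ w => Rpa L Z w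
  | .dr A w => L.ot (Rpa L Z w) A

/-- The natural transformation `κ^f_u` (componentwise). -/
def kappa (L : LD C) {X Y Z : C} (f : X ⟶ L.pa Y Z) :
    (w : ZW C) → (Hpa L X w ⟶ L.pa (Lpa L Y w) (Rpa L Z w))
  | .nil => f
  | .pa A w => L.paHom (𝟙 A) (kappa L f w) ≫ L.pα A (Lpa L Y w) (Rpa L Z w)
  | .painv A w => L.paHom (kappa L f w) (𝟙 A) ≫ L.pαInv (Lpa L Y w) (Rpa L Z w) A
  | .dl A w => L.otHom (𝟙 A) (kappa L f w) ≫ L.δl A (Lpa L Y w) (Rpa L Z w)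
  | .dr A w => L.otHom (kappa L f w) (𝟙 A) ≫ L.δr (Lpa L Y w) (Rpa L Z w) A

/-- `h` is a component of the associator `α`. -/
def IsAlphaComp (L : LD C) {W T : C} (h : W ⟶ T) : Prop :=
  ∃ (A B E : C) (h₁ : W = L.ot A (L.ot B E)) (h₂ : L.ot (L.ot A B) E = T),
    h = eqToHom h₁ ≫ L.α A B E ≫ eqToHom h₂

/-- `h` is a component of the inverse associator `α⁻¹`. -/
def IsAlphaInvComp (L : LD C) {W T : C} (h : W ⟶ T) : Prop :=
  ∃ (A B E : C) (h₁ : W = L.ot (L.ot A B) E) (h₂ : L.ot A (L.ot B E) = T),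
    h = eqToHom h₁ ≫ L.αInv A B E ≫ eqToHom h₂

/-- `h` is a component of the associator `ᾱ`. -/
def IsPalphaComp (L : LD C) {W T : C} (h : W ⟶ T) : Prop :=
  ∃ (A B E : C) (h₁ : W = L.pa A (L.pa B E)) (h₂ : L.pa (L.pa A B) E = T),
    h = eqToHom h₁ ≫ L.pα A B E ≫ eqToHom h₂

/-- `h` is a component of the inverse associator `ᾱ⁻¹`. -/
def IsPalphaInvComp (L : LD C) {W T : C} (h : W ⟶ T) : Prop :=
  ∃ (A B E : C) (h₁ : W = L.pa (L.pa A B) E) (h₂ : L.pa A (L.pa B E) = T),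
    h = eqToHom h₁ ≫ L.pαInv A B E ≫ eqToHom h₂

/-- `h` is a component of the left distributor `δˡ`. -/
def IsDlComp (L : LD C) {W T : C} (h : W ⟶ T) : Prop :=
  ∃ (A B E : C) (h₁ : W = L.ot A (L.pa B E)) (h₂ : L.pa (L.ot A B) E = T),
    h = eqToHom h₁ ≫ L.δl A B E ≫ eqToHom h₂

/-- `h` is a component of the right distributor `δʳ`. -/
def IsDrComp (L : LD C) {W T : C} (h : W ⟶ T) : Prop :=
  ∃ (A B E : C) (h₁ : W = L.ot (L.pa A B) E) (h₂ : L.pa A (L.ot B E) = T),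
    h = eqToHom h₁ ≫ L.δr A B E ≫ eqToHom h₂

/-- `h` is of the form `id_A ⅋ h'` for some morphism `h'`. -/
def IsIdPaLeft (L : LD C) {W T : C} (h : W ⟶ T) : Prop :=
  ∃ (A W' T' : C) (h' : W' ⟶ T') (h₁ : W = L.pa A W') (h₂ : L.pa A T' = T),
    h = eqToHom h₁ ≫ L.paHom (𝟙 A) h' ≫ eqToHom h₂

/-- `h` is of the form `h' ⅋ id_A` for some morphism `h'`. -/
def IsIdPaRight (L : LD C) {W T : C} (h : W ⟶ T) : Prop :=
  ∃ (A W' T' : C) (h' : W' ⟶ T') (h₁ : W = L.pa W' A) (h₂ : L.pa T' A = T),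
    h = eqToHom h₁ ≫ L.paHom h' (𝟙 A) ≫ eqToHom h₂

/-- The set `Id^⊗` of identities of ⊗-products, as a set of morphisms into ⊗-products. -/
def IdOtSet (L : LD C) ⦃X Y Z : C⦄ (f : X ⟶ L.ot Y Z) : Prop :=
  ∃ hE : X = L.ot Y Z, f = eqToHom hE

/-- The set `Id^⅋` of identities of ⅋-products, as a set of morphisms into ⅋-products. -/
def IdPaSet (L : LD C) ⦃X Y Z : C⦄ (f : X ⟶ L.pa Y Z) : Prop :=
  ∃ hE : X = L.pa Y Z, f = eqToHom hE

/-- `𝔣`-analysability for a set `𝔣` of morphisms whose targets are ⊗-products: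
`g = (g' ⊗ g'') ∘ τ^f_u(Ā)` for some `f ∈ 𝔣`, word `u`, vector `Ā` and morphisms `g', g''`. -/
def OtAnalysable (L : LD C) (𝔣 : ∀ ⦃X Y Z : C⦄, (X ⟶ L.ot Y Z) → Prop)
    {P T : C} (g : P ⟶ T) : Prop :=
  ∃ (X Y Z : C) (f : X ⟶ L.ot Y Z), 𝔣 f ∧
    ∃ (w : YW C) (Q₁ Q₂ : C) (g' : Lot L Y w ⟶ Q₁) (g'' : Rot L Z w ⟶ Q₂)
      (hP : P = Hot L X w) (hT : L.ot Q₁ Q₂ = T),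
      g = eqToHom hP ≫ tau L f w ≫ L.otHom g' g'' ≫ eqToHom hT

/-- `𝔣`-analysability for a set `𝔣` of morphisms whose targets are ⅋-products:
`g = (g' ⅋ g'') ∘ κ^f_u(Ā)` for some `f ∈ 𝔣`, word `u`, vector `Ā` and morphisms `g', g''`. -/
def PaAnalysable (L : LD C) (𝔣 : ∀ ⦃X Y Z : C⦄, (X ⟶ L.pa Y Z) → Prop)
    {P T : C} (g : P ⟶ T) : Prop :=
  ∃ (X Y Z : C) (f : X ⟶ L.pa Y Z), 𝔣 f ∧
    ∃ (w : ZW C) (Q₁ Q₂ : C) (g' : Lpa L Y w ⟶ Q₁) (g'' : Rpa L Z w ⟶ Q₂)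
      (hP : P = Hpa L X w) (hT : L.pa Q₁ Q₂ = T),
      g = eqToHom hP ≫ kappa L f w ≫ L.paHom g' g'' ≫ eqToHom hT

/-- Atomic morphisms of a (tidy) LD category. -/
inductive Atomic (L : LD C) : ∀ {W T : C}, (W ⟶ T) → Prop
  | alpha (A B E : C) : Atomic L (L.α A B E)
  | alphaInv (A B E : C) : Atomic L (L.αInv A B E)
  | palpha (A B E : C) : Atomic L (L.pα A B E)
  | palphaInv (A B E : C) : Atomic L (L.pαInv A B E)
  | dl (A B E : C) : Atomic L (L.δl A B E)
  | dr (A B E : C) : Atomic L (L.δr A B E)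
  | otRightId {W T : C} (f : W ⟶ T) (A : C) : Atomic L f → Atomic L (L.otHom f (𝟙 A))
  | otLeftId {W T : C} (f : W ⟶ T) (A : C) : Atomic L f → Atomic L (L.otHom (𝟙 A) f)
  | paRightId {W T : C} (f : W ⟶ T) (A : C) : Atomic L f → Atomic L (L.paHom f (𝟙 A))
  | paLeftId {W T : C} (f : W ⟶ T) (A : C) : Atomic L f → Atomic L (L.paHom (𝟙 A) f)

/-- Elementary morphisms: identities and finite composites of atomic morphisms. -/
inductive Elementary (L : LD C) : ∀ {W T : C}, (W ⟶ T) → Prop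
  | id (X : C) : Elementary L (𝟙 X)
  | of {W T : C} {f : W ⟶ T} : Atomic L f → Elementary L f
  | comp {W T U : C} {f : W ⟶ T} {g : T ⟶ U} :
      Elementary L f → Elementary L g → Elementary L (f ≫ g)

/-- A strict Frobenius linearly distributive functor between LD categories. -/
structure StrictLDFunctor (Cc : Type u₁) [Category.{v₁} Cc] (Dd : Type u₂) [Category.{v₂} Dd]
    (LC : LD Cc) (LDd : LD Dd) where
  toFunctor : Cc ⥤ Dd
  obj_ot : ∀ X Y : Cc, toFunctor.obj (LC.ot X Y) = LDd.ot (toFunctor.obj X) (toFunctor.obj Y)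
  obj_pa : ∀ X Y : Cc, toFunctor.obj (LC.pa X Y) = LDd.pa (toFunctor.obj X) (toFunctor.obj Y)
  map_ot : ∀ {X₁ Y₁ X₂ Y₂ : Cc} (f : X₁ ⟶ Y₁) (g : X₂ ⟶ Y₂),
    toFunctor.map (LC.otHom f g) =
      eqToHom (obj_ot X₁ X₂) ≫ LDd.otHom (toFunctor.map f) (toFunctor.map g) ≫
        eqToHom (obj_ot Y₁ Y₂).symm
  map_pa : ∀ {X₁ Y₁ X₂ Y₂ : Cc} (f : X₁ ⟶ Y₁) (g : X₂ ⟶ Y₂),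
    toFunctor.map (LC.paHom f g) =
      eqToHom (obj_pa X₁ X₂) ≫ LDd.paHom (toFunctor.map f) (toFunctor.map g) ≫
        eqToHom (obj_pa Y₁ Y₂).symm
  map_α : ∀ A B E : Cc,
    toFunctor.map (LC.α A B E) =
      eqToHom (by simp only [obj_ot]) ≫
        LDd.α (toFunctor.obj A) (toFunctor.obj B) (toFunctor.obj E) ≫
        eqToHom (by simp only [obj_ot])
  map_αInv : ∀ A B E : Cc,
    toFunctor.map (LC.αInv A B E) =
      eqToHom (by simp only [obj_ot]) ≫
        LDd.αInv (toFunctor.obj A) (toFunctor.obj B) (toFunctor.obj E) ≫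
        eqToHom (by simp only [obj_ot])
  map_pα : ∀ A B E : Cc,
    toFunctor.map (LC.pα A B E) =
      eqToHom (by simp only [obj_pa]) ≫
        LDd.pα (toFunctor.obj A) (toFunctor.obj B) (toFunctor.obj E) ≫
        eqToHom (by simp only [obj_pa])
  map_pαInv : ∀ A B E : Cc,
    toFunctor.map (LC.pαInv A B E) =
      eqToHom (by simp only [obj_pa]) ≫
        LDd.pαInv (toFunctor.obj A) (toFunctor.obj B) (toFunctor.obj E) ≫
        eqToHom (by simp only [obj_pa])
  map_δl : ∀ A B E : Cc,
    toFunctor.map (LC.δl A B E) =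
      eqToHom (by simp only [obj_ot, obj_pa]) ≫
        LDd.δl (toFunctor.obj A) (toFunctor.obj B) (toFunctor.obj E) ≫
        eqToHom (by simp only [obj_ot, obj_pa])
  map_δr : ∀ A B E : Cc,
    toFunctor.map (LC.δr A B E) =
      eqToHom (by simp only [obj_ot, obj_pa]) ≫
        LDd.δr (toFunctor.obj A) (toFunctor.obj B) (toFunctor.obj E) ≫
        eqToHom (by simp only [obj_ot, obj_pa])

/-- A (unitless) Frobenius linearly distributive functor between LD categories. -/
structure FrobLDFunctor (Cc : Type u₁) [Category.{v₁} Cc] (Dd : Type u₂) [Category.{v₂} Dd]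
    (LC : LD Cc) (LDd : LD Dd) where
  toFunctor : Cc ⥤ Dd
  μ : ∀ X Y : Cc, LDd.ot (toFunctor.obj X) (toFunctor.obj Y) ⟶ toFunctor.obj (LC.ot X Y)
  Δ : ∀ X Y : Cc, toFunctor.obj (LC.pa X Y) ⟶ LDd.pa (toFunctor.obj X) (toFunctor.obj Y)
  μ_natural : ∀ {X₁ Y₁ X₂ Y₂ : Cc} (f : X₁ ⟶ Y₁) (g : X₂ ⟶ Y₂),
    LDd.otHom (toFunctor.map f) (toFunctor.map g) ≫ μ Y₁ Y₂ =
      μ X₁ X₂ ≫ toFunctor.map (LC.otHom f g)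
  Δ_natural : ∀ {X₁ Y₁ X₂ Y₂ : Cc} (f : X₁ ⟶ Y₁) (g : X₂ ⟶ Y₂),
    toFunctor.map (LC.paHom f g) ≫ Δ Y₁ Y₂ =
      Δ X₁ X₂ ≫ LDd.paHom (toFunctor.map f) (toFunctor.map g)
  H1 : ∀ A B E : Cc,
    LDd.α (toFunctor.obj A) (toFunctor.obj B) (toFunctor.obj E) ≫
        LDd.otHom (μ A B) (𝟙 (toFunctor.obj E)) ≫ μ (LC.ot A B) E =
      LDd.otHom (𝟙 (toFunctor.obj A)) (μ B E) ≫ μ A (LC.ot B E) ≫ toFunctor.map (LC.α A B E)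
  H2 : ∀ A B E : Cc,
    LDd.otHom (𝟙 (toFunctor.obj A)) (Δ B E) ≫
        LDd.δl (toFunctor.obj A) (toFunctor.obj B) (toFunctor.obj E) ≫
        LDd.paHom (μ A B) (𝟙 (toFunctor.obj E)) =
      μ A (LC.pa B E) ≫ toFunctor.map (LC.δl A B E) ≫ Δ (LC.ot A B) E
  H3 : ∀ A B E : Cc,
    LDd.otHom (Δ A B) (𝟙 (toFunctor.obj E)) ≫
        LDd.δr (toFunctor.obj A) (toFunctor.obj B) (toFunctor.obj E) ≫
        LDd.paHom (𝟙 (toFunctor.obj A)) (μ B E) =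
      μ (LC.pa A B) E ≫ toFunctor.map (LC.δr A B E) ≫ Δ A (LC.ot B E)
  H4 : ∀ A B E : Cc,
    Δ A (LC.pa B E) ≫ LDd.paHom (𝟙 (toFunctor.obj A)) (Δ B E) ≫
        LDd.pα (toFunctor.obj A) (toFunctor.obj B) (toFunctor.obj E) =
      toFunctor.map (LC.pα A B E) ≫ Δ (LC.pa A B) E ≫
        LDd.paHom (Δ A B) (𝟙 (toFunctor.obj E))

variable {Cc : Type u₁} [Category.{v₁} Cc] {Dd : Type u₂} [Category.{v₂} Dd]
  {LC : LD Cc} {LDd : LD Dd}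

/-- Tidiness of a Frobenius LD functor: the image of an object is never a tensor product. -/
def FrobLDFunctor.TidyF (F : FrobLDFunctor Cc Dd LC LDd) : Prop :=
  ∀ (A : Cc) (P Q : Dd),
    F.toFunctor.obj A ≠ LDd.ot P Q ∧ F.toFunctor.obj A ≠ LDd.pa P Q

/-- Multiplicative morphisms of the target category of a Frobenius LD functor. -/
inductive Multiplicative (F : FrobLDFunctor Cc Dd LC LDd) : ∀ {W T : Dd}, (W ⟶ T) → Prop
  | id (X : Cc) : Multiplicative F (𝟙 (F.toFunctor.obj X))
  | mu {W₁ W₂ : Dd} {X Y : Cc} (f : W₁ ⟶ F.toFunctor.obj X) (g : W₂ ⟶ F.toFunctor.obj Y) :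
      Multiplicative F f → Multiplicative F g →
      Multiplicative F (LDd.otHom f g ≫ F.μ X Y)

/-- `F`-atomic morphisms of the target category of a Frobenius LD functor. -/
inductive FAtomic (F : FrobLDFunctor Cc Dd LC LDd) : ∀ {W T : Dd}, (W ⟶ T) → Prop
  | alpha (A B E : Dd) : FAtomic F (LDd.α A B E)
  | alphaInv (A B E : Dd) : FAtomic F (LDd.αInv A B E)
  | palpha (A B E : Dd) : FAtomic F (LDd.pα A B E)
  | palphaInv (A B E : Dd) : FAtomic F (LDd.pαInv A B E)
  | dl (A B E : Dd) : FAtomic F (LDd.δl A B E)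
  | dr (A B E : Dd) : FAtomic F (LDd.δr A B E)
  | mu (X Y : Cc) : FAtomic F (F.μ X Y)
  | delta (X Y : Cc) : FAtomic F (F.Δ X Y)
  | map {X Y : Cc} (f : X ⟶ Y) : Elementary LC f → FAtomic F (F.toFunctor.map f)
  | otRightId {W T : Dd} (f : W ⟶ T) (A : Dd) : FAtomic F f → FAtomic F (LDd.otHom f (𝟙 A))
  | otLeftId {W T : Dd} (f : W ⟶ T) (A : Dd) : FAtomic F f → FAtomic F (LDd.otHom (𝟙 A) f)
  | paRightId {W T : Dd} (f : W ⟶ T) (A : Dd) : FAtomic F f → FAtomic F (LDd.paHom f (𝟙 A))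
  | paLeftId {W T : Dd} (f : W ⟶ T) (A : Dd) : FAtomic F f → FAtomic F (LDd.paHom (𝟙 A) f)

/-- `F`-elementary morphisms: identities and finite composites of `F`-atomic morphisms. -/
inductive FElementary (F : FrobLDFunctor Cc Dd LC LDd) : ∀ {W T : Dd}, (W ⟶ T) → Prop
  | id (X : Dd) : FElementary F (𝟙 X)
  | of {W T : Dd} {f : W ⟶ T} : FAtomic F f → FElementary F f
  | comp {W T U : Dd} {f : W ⟶ T} {g : T ⟶ U} :
      FElementary F f → FElementary F g → FElementary F (f ≫ g)

/-- The set `𝔡` of morphisms of the form `Δ ∘ F(κ^i_u(X̄))`, where `i` is the identity of a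
⅋-product of the source category. -/
def frakD (F : FrobLDFunctor Cc Dd LC LDd) ⦃P Q₁ Q₂ : Dd⦄ (g : P ⟶ LDd.pa Q₁ Q₂) : Prop :=
  ∃ (Y Z : Cc) (w : ZW Cc) (hP : P = F.toFunctor.obj (Hpa LC (LC.pa Y Z) w))
    (h₁ : F.toFunctor.obj (Lpa LC Y w) = Q₁) (h₂ : F.toFunctor.obj (Rpa LC Z w) = Q₂),
    g = eqToHom hP ≫ F.toFunctor.map (kappa LC (𝟙 (LC.pa Y Z)) w) ≫
        F.Δ (Lpa LC Y w) (Rpa LC Z w) ≫ eqToHom (by rw [h₁, h₂])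


/-! ### Diagrams in a linearly distributive category -/

/-- A unitless (semigroupal) monoidal structure: what `⊗` and `⅋` have in common. -/
structure Semigroupal (C : Type u) [Category.{v} C] where
  ot : C → C → C
  hom : ∀ {X₁ Y₁ X₂ Y₂ : C}, (X₁ ⟶ Y₁) → (X₂ ⟶ Y₂) → (ot X₁ X₂ ⟶ ot Y₁ Y₂)
  hom_id : ∀ X Y : C, hom (𝟙 X) (𝟙 Y) = 𝟙 (ot X Y)
  hom_comp :
    ∀ {X₁ Y₁ Z₁ X₂ Y₂ Z₂ : C} (f₁ : X₁ ⟶ Y₁) (g₁ : Y₁ ⟶ Z₁) (f₂ : X₂ ⟶ Y₂) (g₂ : Y₂ ⟶ Z₂),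
      hom (f₁ ≫ g₁) (f₂ ≫ g₂) = hom f₁ f₂ ≫ hom g₁ g₂
  α : ∀ A B E : C, ot A (ot B E) ⟶ ot (ot A B) E
  αInv : ∀ A B E : C, ot (ot A B) E ⟶ ot A (ot B E)
  α_αInv : ∀ A B E : C, α A B E ≫ αInv A B E = 𝟙 _
  αInv_α : ∀ A B E : C, αInv A B E ≫ α A B E = 𝟙 _
  α_natural :
    ∀ {A A' B B' E E' : C} (f : A ⟶ A') (g : B ⟶ B') (h : E ⟶ E'),
      hom f (hom g h) ≫ α A' B' E' = α A B E ≫ hom (hom f g) h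
  pentagon : ∀ A B E D : C,
    α A B (ot E D) ≫ α (ot A B) E D =
      hom (𝟙 A) (α B E D) ≫ α A (ot B E) D ≫ hom (α A B E) (𝟙 D)

/-- The semigroupal structure given by `⊗`. -/
def LD.otSemigroupal (L : LD C) : Semigroupal C :=
  ⟨L.ot, L.otHom, L.otHom_id, L.otHom_comp, L.α, L.αInv, L.α_αInv, L.αInv_α, L.α_natural, L.P1⟩

/-- The semigroupal structure given by `⅋`. -/
def LD.paSemigroupal (L : LD C) : Semigroupal C :=
  ⟨L.pa, L.paHom, L.paHom_id, L.paHom_comp, L.pα, L.pαInv, L.pα_pαInv, L.pαInv_pα,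
    L.pα_natural, L.P8⟩

/-- Transport of a commutative square along inverses of its parallel sides. -/
lemma inv_square {X Y X' Y' : C} {a : X ⟶ Y} {a' : Y ⟶ X} {b : X' ⟶ Y'} {b' : Y' ⟶ X'}
    {s : X ⟶ X'} {t : Y ⟶ Y'} (h : a ≫ t = s ≫ b) (ha : a' ≫ a = 𝟙 Y) (hb : b ≫ b' = 𝟙 X') :
    a' ≫ s = t ≫ b' := by
  rw [← Category.comp_id s, ← hb, ← Category.assoc s, ← h, Category.assoc, ← Category.assoc a',
    ha, Category.id_comp]

namespace Semigroupal

variable (M : Semigroupal C)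

lemma hom_comp_id {X Y Z : C} (f : X ⟶ Y) (g : Y ⟶ Z) (A : C) :
    M.hom (f ≫ g) (𝟙 A) = M.hom f (𝟙 A) ≫ M.hom g (𝟙 A) := by
  rw [← M.hom_comp, Category.comp_id]

lemma hom_id_comp {X Y Z : C} (f : X ⟶ Y) (g : Y ⟶ Z) (A : C) :
    M.hom (𝟙 A) (f ≫ g) = M.hom (𝟙 A) f ≫ M.hom (𝟙 A) g := by
  rw [← M.hom_comp, Category.comp_id]

lemma αInv_natural {A A' B B' E E' : C} (f : A ⟶ A') (g : B ⟶ B') (h : E ⟶ E') :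
    M.hom (M.hom f g) h ≫ M.αInv A' B' E' = M.αInv A B E ≫ M.hom f (M.hom g h) :=
  (inv_square (M.α_natural f g h).symm (M.αInv_α _ _ _) (M.α_αInv _ _ _)).symm

lemma hom_id_inv {X Y A : C} {f : X ⟶ Y} {g : Y ⟶ X} (h : f ≫ g = 𝟙 X) :
    M.hom f (𝟙 A) ≫ M.hom g (𝟙 A) = 𝟙 _ := by
  rw [← M.hom_comp_id, h, M.hom_id]

lemma id_hom_inv {X Y A : C} {f : X ⟶ Y} {g : Y ⟶ X} (h : f ≫ g = 𝟙 X) :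
    M.hom (𝟙 A) f ≫ M.hom (𝟙 A) g = 𝟙 _ := by
  rw [← M.hom_id_comp, h, M.hom_id]

lemma comp_hom_id {X Y Z : C} (f : X ⟶ M.ot Y Z) : f ≫ M.hom (𝟙 Y) (𝟙 Z) = f := by
  rw [M.hom_id, Category.comp_id]

lemma hom_left {P P' L L' R R' A A' : C} {f : A' ⟶ A} {g : P' ⟶ P} {m : P ⟶ M.ot L R}
    {m' : P' ⟶ M.ot L' R'} {l : L' ⟶ L} {r : R' ⟶ R} (h : g ≫ m = m' ≫ M.hom l r) :
    M.hom f g ≫ M.hom (𝟙 A) m ≫ M.α A L R =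
      (M.hom (𝟙 A') m' ≫ M.α A' L' R') ≫ M.hom (M.hom f l) r := by
  rw [Category.assoc, ← M.α_natural, ← Category.assoc, ← Category.assoc, ← M.hom_comp,
    ← M.hom_comp, h, Category.comp_id, Category.id_comp]

lemma hom_right {P P' L L' R R' A A' : C} {f : A' ⟶ A} {g : P' ⟶ P} {m : P ⟶ M.ot L R}
    {m' : P' ⟶ M.ot L' R'} {l : L' ⟶ L} {r : R' ⟶ R} (h : g ≫ m = m' ≫ M.hom l r) :
    M.hom g f ≫ M.hom m (𝟙 A) ≫ M.αInv L R A =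
      (M.hom m' (𝟙 A') ≫ M.αInv L' R' A') ≫ M.hom l (M.hom r f) := by
  rw [Category.assoc, ← M.αInv_natural, ← Category.assoc, ← Category.assoc, ← M.hom_comp,
    ← M.hom_comp, h, Category.comp_id, Category.id_comp]

lemma α_here (A B E : C) :
    M.α A B E ≫ 𝟙 _ =
      (M.hom (𝟙 A) (𝟙 (M.ot B E)) ≫ M.α A B E) ≫ M.hom (𝟙 (M.ot A B)) (𝟙 E) := by
  simp [M.hom_id]

lemma α_right_here (A B E : C) :
    M.α A B E ≫ M.hom (𝟙 (M.ot A B)) (𝟙 E) ≫ M.αInv A B E =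
      𝟙 _ ≫ M.hom (𝟙 A) (𝟙 (M.ot B E)) := by
  simp [M.hom_id, M.α_αInv]

lemma α_left (A B : C) {E L R : C} (m : E ⟶ M.ot L R) :
    M.α A B E ≫ M.hom (𝟙 (M.ot A B)) m ≫ M.α (M.ot A B) L R =
      (M.hom (𝟙 A) (M.hom (𝟙 B) m ≫ M.α B L R) ≫ M.α A (M.ot B L) R) ≫
        M.hom (M.α A B L) (𝟙 R) := by
  rw [M.hom_id_comp, Category.assoc, Category.assoc, ← M.pentagon, ← Category.assoc,
    ← M.hom_id A B, ← M.α_natural, Category.assoc]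

lemma α_right_left (A E : C) {B L R : C} (m : B ⟶ M.ot L R) :
    M.α A B E ≫ M.hom (M.hom (𝟙 A) m ≫ M.α A L R) (𝟙 E) ≫ M.αInv (M.ot A L) R E =
      (M.hom (𝟙 A) (M.hom m (𝟙 E) ≫ M.αInv L R E) ≫ M.α A L (M.ot R E)) ≫
        M.hom (𝟙 (M.ot A L)) (𝟙 (M.ot R E)) := by
  rw [M.comp_hom_id, M.hom_comp_id, M.hom_id_comp, Category.assoc, Category.assoc,
    ← Category.assoc (M.α A B E), ← M.α_natural, Category.assoc]
  congr 1
  rw [← Category.assoc]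
  exact (inv_square (M.pentagon A L R E).symm (M.id_hom_inv (M.αInv_α _ _ _))
    (M.α_αInv _ _ _)).symm

lemma α_right_right (B E : C) {A L R : C} (m : A ⟶ M.ot L R) :
    M.α A B E ≫ M.hom (M.hom m (𝟙 B) ≫ M.αInv L R B) (𝟙 E) ≫ M.αInv L (M.ot R B) E =
      (M.hom m (𝟙 (M.ot B E)) ≫ M.αInv L R (M.ot B E)) ≫ M.hom (𝟙 L) (M.α R B E) := by
  rw [M.hom_comp_id, Category.assoc, Category.assoc,
    ← Category.assoc (M.α A B E), ← M.α_natural, Category.assoc, M.hom_id]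
  congr 1
  refine (inv_square (M.pentagon L R B E) (M.αInv_α _ _ _) ?_).symm
  rw [Category.assoc, ← Category.assoc (M.hom _ _), M.hom_id_inv (M.α_αInv _ _ _),
    Category.id_comp, M.α_αInv]

end Semigroupal

namespace LD

variable (L : LD C)

lemma otHom_comp_id {X Y Z : C} (f : X ⟶ Y) (g : Y ⟶ Z) (A : C) :
    L.otHom (f ≫ g) (𝟙 A) = L.otHom f (𝟙 A) ≫ L.otHom g (𝟙 A) :=
  L.otSemigroupal.hom_comp_id f g A

lemma otHom_id_comp {X Y Z : C} (f : X ⟶ Y) (g : Y ⟶ Z) (A : C) :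
    L.otHom (𝟙 A) (f ≫ g) = L.otHom (𝟙 A) f ≫ L.otHom (𝟙 A) g :=
  L.otSemigroupal.hom_id_comp f g A

lemma paHom_comp_id {X Y Z : C} (f : X ⟶ Y) (g : Y ⟶ Z) (A : C) :
    L.paHom (f ≫ g) (𝟙 A) = L.paHom f (𝟙 A) ≫ L.paHom g (𝟙 A) :=
  L.paSemigroupal.hom_comp_id f g A

lemma paHom_id_comp {X Y Z : C} (f : X ⟶ Y) (g : Y ⟶ Z) (A : C) :
    L.paHom (𝟙 A) (f ≫ g) = L.paHom (𝟙 A) f ≫ L.paHom (𝟙 A) g :=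
  L.paSemigroupal.hom_id_comp f g A

lemma comp_paHom_id {X Y Z : C} (f : X ⟶ L.pa Y Z) : f ≫ L.paHom (𝟙 Y) (𝟙 Z) = f :=
  L.paSemigroupal.comp_hom_id f

lemma otHom_dl {P P' U U' R R' A A' : C} {f : A' ⟶ A} {g : P' ⟶ P} {m : P ⟶ L.pa U R}
    {m' : P' ⟶ L.pa U' R'} {l : U' ⟶ U} {r : R' ⟶ R} (h : g ≫ m = m' ≫ L.paHom l r) :
    L.otHom f g ≫ L.otHom (𝟙 A) m ≫ L.δl A U R =
      (L.otHom (𝟙 A') m' ≫ L.δl A' U' R') ≫ L.paHom (L.otHom f l) r := by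
  rw [Category.assoc, ← L.δl_natural, ← Category.assoc, ← Category.assoc, ← L.otHom_comp,
    ← L.otHom_comp, h, Category.comp_id, Category.id_comp]

lemma otHom_dr {P P' U U' R R' A A' : C} {f : A' ⟶ A} {g : P' ⟶ P} {m : P ⟶ L.pa U R}
    {m' : P' ⟶ L.pa U' R'} {l : U' ⟶ U} {r : R' ⟶ R} (h : g ≫ m = m' ≫ L.paHom l r) :
    L.otHom g f ≫ L.otHom m (𝟙 A) ≫ L.δr U R A =
      (L.otHom m' (𝟙 A') ≫ L.δr U' R' A') ≫ L.paHom l (L.otHom r f) := by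
  rw [Category.assoc, ← L.δr_natural, ← Category.assoc, ← Category.assoc, ← L.otHom_comp,
    ← L.otHom_comp, h, Category.comp_id, Category.id_comp]

lemma α_dl (A B : C) {E U R : C} (m : E ⟶ L.pa U R) :
    L.α A B E ≫ L.otHom (𝟙 (L.ot A B)) m ≫ L.δl (L.ot A B) U R =
      (L.otHom (𝟙 A) (L.otHom (𝟙 B) m ≫ L.δl B U R) ≫ L.δl A (L.ot B U) R) ≫
        L.paHom (L.α A B U) (𝟙 R) := by
  rw [L.otHom_id_comp, Category.assoc, Category.assoc, ← L.P2, ← Category.assoc,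
    ← L.otHom_id A B, ← L.α_natural, Category.assoc]

lemma α_dr_dl (A E : C) {B U R : C} (m : B ⟶ L.pa U R) :
    L.α A B E ≫ L.otHom (L.otHom (𝟙 A) m ≫ L.δl A U R) (𝟙 E) ≫ L.δr (L.ot A U) R E =
      (L.otHom (𝟙 A) (L.otHom m (𝟙 E) ≫ L.δr U R E) ≫ L.δl A U (L.ot R E)) ≫
        L.paHom (𝟙 (L.ot A U)) (𝟙 (L.ot R E)) := by
  rw [L.comp_paHom_id, L.otHom_id_comp, L.otHom_comp_id, Category.assoc, Category.assoc, L.P3,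
    ← Category.assoc (L.α A B E), ← L.α_natural, Category.assoc]

lemma α_dr_dr (B E : C) {A U R : C} (m : A ⟶ L.pa U R) :
    L.α A B E ≫ L.otHom (L.otHom m (𝟙 B) ≫ L.δr U R B) (𝟙 E) ≫ L.δr U (L.ot R B) E =
      (L.otHom m (𝟙 (L.ot B E)) ≫ L.δr U R (L.ot B E)) ≫ L.paHom (𝟙 U) (L.α R B E) := by
  rw [L.otHom_comp_id, Category.assoc, Category.assoc, L.P5, ← L.otHom_id B E,
    ← Category.assoc (L.α A B E), ← L.α_natural, Category.assoc]

lemma δl_here (A B E : C) :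
    L.δl A B E ≫ 𝟙 _ =
      (L.otHom (𝟙 A) (𝟙 (L.pa B E)) ≫ L.δl A B E) ≫ L.paHom (𝟙 (L.ot A B)) (𝟙 E) := by
  simp [L.otHom_id, L.paHom_id]

lemma δl_left (A B : C) {E U R : C} (m : E ⟶ L.pa U R) :
    L.δl A B E ≫ L.paHom (𝟙 (L.ot A B)) m ≫ L.pα (L.ot A B) U R =
      (L.otHom (𝟙 A) (L.paHom (𝟙 B) m ≫ L.pα B U R) ≫ L.δl A (L.pa B U) R) ≫
        L.paHom (L.δl A B U) (𝟙 R) := by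
  rw [L.otHom_id_comp, Category.assoc, Category.assoc, ← L.P4, ← Category.assoc,
    ← L.otHom_id A B, ← L.δl_natural, Category.assoc]

lemma δl_right_dl (A E : C) {B U R : C} (m : B ⟶ L.pa U R) :
    L.δl A B E ≫ L.paHom (L.otHom (𝟙 A) m ≫ L.δl A U R) (𝟙 E) ≫ L.pαInv (L.ot A U) R E =
      (L.otHom (𝟙 A) (L.paHom m (𝟙 E) ≫ L.pαInv U R E) ≫ L.δl A U (L.pa R E)) ≫
        L.paHom (𝟙 (L.ot A U)) (𝟙 (L.pa R E)) := by
  rw [L.comp_paHom_id, L.otHom_id_comp, L.paHom_comp_id, Category.assoc, Category.assoc,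
    ← Category.assoc (L.δl A B E), ← L.δl_natural, Category.assoc]
  congr 1
  rw [← Category.assoc]
  exact (inv_square (L.P4 A U R E).symm (L.otSemigroupal.id_hom_inv (L.pαInv_pα _ _ _))
    (L.pα_pαInv _ _ _)).symm

lemma δl_right_dr (B E : C) {A U R : C} (m : A ⟶ L.pa U R) :
    L.δl A B E ≫ L.paHom (L.otHom m (𝟙 B) ≫ L.δr U R B) (𝟙 E) ≫ L.pαInv U (L.ot R B) E =
      (L.otHom m (𝟙 (L.pa B E)) ≫ L.δr U R (L.pa B E)) ≫ L.paHom (𝟙 U) (L.δl R B E) := by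
  rw [L.paHom_comp_id, Category.assoc, Category.assoc,
    ← Category.assoc (L.δl A B E), ← L.δl_natural, Category.assoc, L.paHom_id,
    ← Category.assoc (L.δl _ _ _), L.P6]
  simp [L.pα_pαInv]

lemma δr_here (A B E : C) :
    L.δr A B E ≫ 𝟙 _ =
      (L.otHom (𝟙 (L.pa A B)) (𝟙 E) ≫ L.δr A B E) ≫ L.paHom (𝟙 A) (𝟙 (L.ot B E)) := by
  simp [L.otHom_id, L.paHom_id]

lemma δr_right (B E : C) {A U R : C} (m : A ⟶ L.pa U R) :
    L.δr A B E ≫ L.paHom m (𝟙 (L.ot B E)) ≫ L.pαInv U R (L.ot B E) =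
      (L.otHom (L.paHom m (𝟙 B) ≫ L.pαInv U R B) (𝟙 E) ≫ L.δr U (L.pa R B) E) ≫
        L.paHom (𝟙 U) (L.δr R B E) := by
  rw [← L.otHom_id B E, ← Category.assoc, ← L.δr_natural, L.otHom_comp_id, Category.assoc,
    Category.assoc, Category.assoc]
  congr 1
  exact (inv_square ((L.P7 U R B E).trans (Category.assoc _ _ _).symm)
    (L.otSemigroupal.hom_id_inv (L.pαInv_pα _ _ _)) (L.pα_pαInv _ _ _)).symm

lemma δr_left_dl (A B : C) {E U R : C} (m : E ⟶ L.pa U R) :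
    L.δr A B E ≫ L.paHom (𝟙 A) (L.otHom (𝟙 B) m ≫ L.δl B U R) ≫ L.pα A (L.ot B U) R =
      (L.otHom (𝟙 (L.pa A B)) m ≫ L.δl (L.pa A B) U R) ≫ L.paHom (L.δr A B U) (𝟙 R) := by
  rw [L.paHom_id_comp, Category.assoc, Category.assoc, L.P6, ← L.paHom_id A B,
    ← Category.assoc (L.δr A B E), ← L.δr_natural, Category.assoc]

lemma δr_left_dr (A E : C) {B U R : C} (m : B ⟶ L.pa U R) :
    L.δr A B E ≫ L.paHom (𝟙 A) (L.otHom m (𝟙 E) ≫ L.δr U R E) ≫ L.pα A U (L.ot R E) =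
      (L.otHom (L.paHom (𝟙 A) m ≫ L.pα A U R) (𝟙 E) ≫ L.δr (L.pa A U) R E) ≫
        L.paHom (𝟙 (L.pa A U)) (𝟙 (L.ot R E)) := by
  rw [L.comp_paHom_id, L.paHom_id_comp, L.otHom_comp_id, Category.assoc, Category.assoc, L.P7,
    ← Category.assoc (L.δr A B E), ← L.δr_natural, Category.assoc]

end LD

/-! ### Formulas and definable morphisms -/

/-- Formal objects: the objects of the free linearly distributive category on `S`. -/
inductive Formula (S : Type u₁) : Type u₁
  | var : S → Formula S
  | ot : Formula S → Formula S → Formula S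
  | pa : Formula S → Formula S → Formula S

namespace Formula

variable {S : Type u₁}

/-- The number of variable occurrences. -/
def size : Formula S → ℕ
  | var _ => 1
  | ot A B => A.size + B.size
  | pa A B => A.size + B.size

lemma size_pos : ∀ A : Formula S, 0 < A.size
  | var _ => Nat.one_pos
  | ot A _ => Nat.add_pos_left A.size_pos _
  | pa A _ => Nat.add_pos_left A.size_pos _

/-- The value of a formula in a linearly distributive category. -/
def val (L : LD C) (η : S → C) : Formula S → C
  | var s => η s
  | ot A B => L.ot (val L η A) (val L η B)
  | pa A B => L.pa (val L η A) (val L η B)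

end Formula

open Formula

variable {S : Type u₁} {L : LD C} {η : S → C}

/-- Morphisms between values of formulas that are built from the structure of `L`. -/
inductive Definable (L : LD C) (η : S → C) :
    ∀ {A B : Formula S}, (val L η A ⟶ val L η B) → Prop
  | id (A : Formula S) : Definable L η (𝟙 (val L η A))
  | comp {A B E : Formula S} {f : val L η A ⟶ val L η B} {g : val L η B ⟶ val L η E} :
      Definable L η f → Definable L η g → Definable L η (f ≫ g)
  | otHom {A A' B B' : Formula S} {f : val L η A ⟶ val L η A'} {g : val L η B ⟶ val L η B'} :
      Definable L η f → Definable L η g →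
      Definable L η (A := ot A B) (B := ot A' B') (L.otHom f g)
  | paHom {A A' B B' : Formula S} {f : val L η A ⟶ val L η A'} {g : val L η B ⟶ val L η B'} :
      Definable L η f → Definable L η g →
      Definable L η (A := pa A B) (B := pa A' B') (L.paHom f g)
  | α (A B E : Formula S) :
      Definable L η (A := ot A (ot B E)) (B := ot (ot A B) E) (L.α _ _ _)
  | αInv (A B E : Formula S) :
      Definable L η (A := ot (ot A B) E) (B := ot A (ot B E)) (L.αInv _ _ _)
  | pα (A B E : Formula S) :
      Definable L η (A := pa A (pa B E)) (B := pa (pa A B) E) (L.pα _ _ _)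
  | pαInv (A B E : Formula S) :
      Definable L η (A := pa (pa A B) E) (B := pa A (pa B E)) (L.pαInv _ _ _)
  | δl (A B E : Formula S) :
      Definable L η (A := ot A (pa B E)) (B := pa (ot A B) E) (L.δl _ _ _)
  | δr (A B E : Formula S) :
      Definable L η (A := ot (pa A B) E) (B := pa A (ot B E)) (L.δr _ _ _)

namespace Definable

lemma size_eq {A B : Formula S} {f : val L η A ⟶ val L η B} (h : Definable L η f) :
    A.size = B.size := by
  induction h with
  | id => rfl
  | comp _ _ ihf ihg => exact ihf.trans ihg
  | otHom _ _ ihf ihg => exact congrArg₂ _ ihf ihg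
  | paHom _ _ ihf ihg => exact congrArg₂ _ ihf ihg
  | _ => simp only [size]; omega

/-- A definable morphism out of a formula of size one is an identity. -/
lemma eq_of_size_eq_one {A B : Formula S} {f : val L η A ⟶ val L η B} (h : Definable L η f)
    (hA : A.size = 1) : ∃ e : A = B, f = eqToHom (congrArg (val L η) e) := by
  induction h with
  | id A => exact ⟨rfl, rfl⟩
  | comp hf hg ihf ihg =>
    obtain ⟨rfl, rfl⟩ := ihf hA
    obtain ⟨rfl, rfl⟩ := ihg hA
    exact ⟨rfl, Category.id_comp _⟩
  | @otHom A A' B B' => have := A.size_pos; have := B.size_pos; simp only [size] at hA; omega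
  | @paHom A A' B B' => have := A.size_pos; have := B.size_pos; simp only [size] at hA; omega
  | _ A B E =>
    have := A.size_pos; have := B.size_pos; have := E.size_pos; simp only [size] at hA; omega

end Definable

/-! ### Splittings -/

/-- The canonical splittings `P ⟶ U ⊗ R` of the value of a formula `P`; there is one for each
occurrence of `⊗` in `P` that is reached through occurrences of `⊗` only. -/
inductive OtSplit (L : LD C) (η : S → C) :
    ∀ P U R : Formula S, (val L η P ⟶ L.ot (val L η U) (val L η R)) → Prop
  | here (U R : Formula S) : OtSplit L η (ot U R) U R (𝟙 _)
  | left (A : Formula S) {P U R : Formula S} {m : val L η P ⟶ L.ot (val L η U) (val L η R)} :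
      OtSplit L η P U R m →
      OtSplit L η (ot A P) (ot A U) R (L.otHom (𝟙 (val L η A)) m ≫ L.α _ _ _)
  | right (A : Formula S) {P U R : Formula S} {m : val L η P ⟶ L.ot (val L η U) (val L η R)} :
      OtSplit L η P U R m →
      OtSplit L η (ot P A) U (ot R A) (L.otHom m (𝟙 (val L η A)) ≫ L.αInv _ _ _)

/-- The canonical splittings `P ⟶ U ⅋ R` of the value of a formula `P`; there is one for each
occurrence of `⅋` in `P`. -/
inductive PaSplit (L : LD C) (η : S → C) :
    ∀ P U R : Formula S, (val L η P ⟶ L.pa (val L η U) (val L η R)) → Prop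
  | here (U R : Formula S) : PaSplit L η (pa U R) U R (𝟙 _)
  | left (A : Formula S) {P U R : Formula S} {m : val L η P ⟶ L.pa (val L η U) (val L η R)} :
      PaSplit L η P U R m →
      PaSplit L η (pa A P) (pa A U) R (L.paHom (𝟙 (val L η A)) m ≫ L.pα _ _ _)
  | right (A : Formula S) {P U R : Formula S} {m : val L η P ⟶ L.pa (val L η U) (val L η R)} :
      PaSplit L η P U R m →
      PaSplit L η (pa P A) U (pa R A) (L.paHom m (𝟙 (val L η A)) ≫ L.pαInv _ _ _)
  | dl (A : Formula S) {P U R : Formula S} {m : val L η P ⟶ L.pa (val L η U) (val L η R)} :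
      PaSplit L η P U R m →
      PaSplit L η (ot A P) (ot A U) R (L.otHom (𝟙 (val L η A)) m ≫ L.δl _ _ _)
  | dr (A : Formula S) {P U R : Formula S} {m : val L η P ⟶ L.pa (val L η U) (val L η R)} :
      PaSplit L η P U R m →
      PaSplit L η (ot P A) U (ot R A) (L.otHom m (𝟙 (val L η A)) ≫ L.δr _ _ _)

namespace OtSplit

lemma size_add {P U R : Formula S} {m : val L η P ⟶ L.ot (val L η U) (val L η R)}
    (h : OtSplit L η P U R m) : U.size + R.size = P.size := by
  induction h <;> simp only [size] <;> omega

/-- A splitting is determined by the size of its left part. -/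
lemma unique {P U R U' R' : Formula S} {m : val L η P ⟶ L.ot (val L η U) (val L η R)}
    {m' : val L η P ⟶ L.ot (val L η U') (val L η R')}
    (h : OtSplit L η P U R m) (h' : OtSplit L η P U' R' m') (hs : U.size = U'.size) :
    U = U' ∧ R = R' ∧ HEq m m' := by
  induction h generalizing U' R' with
  | here U R =>
    cases h' with
    | here => exact ⟨rfl, rfl, HEq.rfl⟩
    | @left _ _ V _ _ h' => have := V.size_pos; simp only [size] at hs; omega
    | @right _ _ V W _ h' => have := h'.size_add; have := W.size_pos; omega
  | @left A P U R m h ih =>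
    cases h' with
    | here => have := U.size_pos; simp only [size] at hs; omega
    | left _ h' =>
      obtain ⟨rfl, rfl, hm⟩ := ih h' (by simp only [size] at hs; omega)
      cases hm
      exact ⟨rfl, rfl, HEq.rfl⟩
    | right _ h' => have := h'.size_add; have := U.size_pos; simp only [size] at hs; omega
  | @right A P U R m h ih =>
    have hP := h.size_add
    have hR := R.size_pos
    cases h' with
    | here => omega
    | left _ h' => simp only [size] at hs; omega
    | right _ h' =>
      obtain ⟨rfl, rfl, hm⟩ := ih h' hs
      cases hm
      exact ⟨rfl, rfl, HEq.rfl⟩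

/-- Splittings can be pulled back along definable morphisms. -/
lemma lift {P' P : Formula S} {f : val L η P' ⟶ val L η P} (hf : Definable L η f)
    {U R : Formula S} {m : val L η P ⟶ L.ot (val L η U) (val L η R)} (h : OtSplit L η P U R m) :
    ∃ (U' R' : Formula S) (m' : val L η P' ⟶ L.ot (val L η U') (val L η R'))
      (l : val L η U' ⟶ val L η U) (r : val L η R' ⟶ val L η R),
      OtSplit L η P' U' R' m' ∧ Definable L η l ∧ Definable L η r ∧
        f ≫ m = m' ≫ L.otHom l r := by
  let M := L.otSemigroupal
  induction hf generalizing U R with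
  | id A =>
    exact ⟨_, _, m, _, _, h, .id _, .id _, (Category.id_comp m).trans (M.comp_hom_id m).symm⟩
  | @comp A B E f g hf hg ihf ihg =>
    obtain ⟨_, _, m₁, l₁, r₁, h₁, hl₁, hr₁, e₁⟩ := ihg h
    obtain ⟨_, _, m₂, l₂, r₂, h₂, hl₂, hr₂, e₂⟩ := ihf h₁
    refine ⟨_, _, m₂, _, _, h₂, hl₂.comp hl₁, hr₂.comp hr₁, ?_⟩
    rw [Category.assoc, e₁, ← Category.assoc, e₂, Category.assoc, L.otHom_comp]
  | @otHom A A' B B' f g hf hg ihf ihg =>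
    cases h with
    | here =>
      exact ⟨_, _, _, _, _, .here _ _, hf, hg,
        (Category.comp_id (L.otHom f g)).trans (Category.id_comp _).symm⟩
    | left _ h =>
      obtain ⟨_, _, m₁, l₁, r₁, h₁, hl₁, hr₁, e₁⟩ := ihg h
      exact ⟨_, _, _, _, _, .left _ h₁, hf.otHom hl₁, hr₁, M.hom_left e₁⟩
    | right _ h =>
      obtain ⟨_, _, m₁, l₁, r₁, h₁, hl₁, hr₁, e₁⟩ := ihf h
      exact ⟨_, _, _, _, _, .right _ h₁, hl₁, hr₁.otHom hg, M.hom_right e₁⟩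
  | α A B E =>
    cases h with
    | here => exact ⟨_, _, _, _, _, .left _ (.here _ _), .id (ot A B), .id _, M.α_here _ _ _⟩
    | left _ h => exact ⟨_, _, _, _, _, .left _ (.left _ h), .α _ _ _, .id _, M.α_left _ _ _⟩
    | @right _ _ _ R _ h =>
      cases h with
      | here => exact ⟨_, _, _, _, _, .here _ _, .id _, .id (ot B E), M.α_right_here _ _ _⟩
      | @left _ _ V _ _ h =>
        exact ⟨_, _, _, _, _, .left _ (.right _ h), .id (ot A V), .id (ot R E),
          M.α_right_left _ _ _⟩
      | right _ h =>
        exact ⟨_, _, _, _, _, .right _ h, .id _, .α _ _ _, M.α_right_right _ _ _⟩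
  | αInv A B E =>
    cases h with
    | here =>
      exact ⟨_, _, _, _, _, .right _ (.here _ _), .id _, .id (ot B E),
        inv_square (M.α_right_here _ _ _) (M.αInv_α _ _ _) (M.id_hom_inv (Category.comp_id _))⟩
    | right _ h =>
      exact ⟨_, _, _, _, _, .right _ (.right _ h), .id _, .αInv _ _ _,
        inv_square (M.α_right_right _ _ _) (M.αInv_α _ _ _) (M.id_hom_inv (M.α_αInv _ _ _))⟩
    | @left _ _ U _ _ h =>
      cases h with
      | here =>
        exact ⟨_, _, _, _, _, .here _ _, .id (ot A B), .id _,
          inv_square (M.α_here _ _ _) (M.αInv_α _ _ _) (M.id_hom_inv (Category.comp_id _))⟩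
      | left _ h =>
        exact ⟨_, _, _, _, _, .left _ h, .αInv _ _ _, .id _,
          inv_square (M.α_left _ _ _) (M.αInv_α _ _ _) (M.hom_id_inv (M.α_αInv _ _ _))⟩
      | @right _ _ _ W _ h =>
        exact ⟨_, _, _, _, _, .right _ (.left _ h), .id (ot A U), .id (ot W E),
          inv_square (M.α_right_left _ _ _) (M.αInv_α _ _ _) (M.id_hom_inv (Category.comp_id _))⟩
  | paHom => cases h
  | pα => cases h
  | pαInv => cases h
  | δl => cases h
  | δr => cases h

end OtSplit

namespace PaSplit

lemma size_add {P U R : Formula S} {m : val L η P ⟶ L.pa (val L η U) (val L η R)}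
    (h : PaSplit L η P U R m) : U.size + R.size = P.size := by
  induction h <;> simp only [size] <;> omega

/-- A splitting is determined by the size of its left part. -/
lemma unique {P U R U' R' : Formula S} {m : val L η P ⟶ L.pa (val L η U) (val L η R)}
    {m' : val L η P ⟶ L.pa (val L η U') (val L η R')}
    (h : PaSplit L η P U R m) (h' : PaSplit L η P U' R' m') (hs : U.size = U'.size) :
    U = U' ∧ R = R' ∧ HEq m m' := by
  induction h generalizing U' R' with
  | here U R =>
    cases h' with
    | here => exact ⟨rfl, rfl, HEq.rfl⟩
    | @left _ _ V _ _ h' => have := V.size_pos; simp only [size] at hs; omega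
    | @right _ _ V W _ h' => have := h'.size_add; have := W.size_pos; omega
  | @left A P U R m h ih =>
    cases h' with
    | here => have := U.size_pos; simp only [size] at hs; omega
    | left _ h' =>
      obtain ⟨rfl, rfl, hm⟩ := ih h' (by simp only [size] at hs; omega)
      cases hm
      exact ⟨rfl, rfl, HEq.rfl⟩
    | right _ h' => have := h'.size_add; have := U.size_pos; simp only [size] at hs; omega
  | @right A P U R m h ih =>
    have hP := h.size_add
    have hR := R.size_pos
    cases h' with
    | here => omega
    | left _ h' => simp only [size] at hs; omega
    | right _ h' =>
      obtain ⟨rfl, rfl, hm⟩ := ih h' hs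
      cases hm
      exact ⟨rfl, rfl, HEq.rfl⟩
  | @dl A P U R m h ih =>
    cases h' with
    | dl _ h' =>
      obtain ⟨rfl, rfl, hm⟩ := ih h' (by simp only [size] at hs; omega)
      cases hm
      exact ⟨rfl, rfl, HEq.rfl⟩
    | dr _ h' => have := h'.size_add; have := U.size_pos; simp only [size] at hs; omega
  | @dr A P U R m h ih =>
    have hP := h.size_add
    have hR := R.size_pos
    cases h' with
    | dl _ h' => simp only [size] at hs; omega
    | dr _ h' =>
      obtain ⟨rfl, rfl, hm⟩ := ih h' hs
      cases hm
      exact ⟨rfl, rfl, HEq.rfl⟩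

/-- Splittings can be pulled back along definable morphisms. -/
lemma lift {P' P : Formula S} {f : val L η P' ⟶ val L η P} (hf : Definable L η f)
    {U R : Formula S} {m : val L η P ⟶ L.pa (val L η U) (val L η R)} (h : PaSplit L η P U R m) :
    ∃ (U' R' : Formula S) (m' : val L η P' ⟶ L.pa (val L η U') (val L η R'))
      (l : val L η U' ⟶ val L η U) (r : val L η R' ⟶ val L η R),
      PaSplit L η P' U' R' m' ∧ Definable L η l ∧ Definable L η r ∧
        f ≫ m = m' ≫ L.paHom l r := by
  let M := L.paSemigroupal
  induction hf generalizing U R with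
  | id A =>
    exact ⟨_, _, m, _, _, h, .id _, .id _, (Category.id_comp m).trans (M.comp_hom_id m).symm⟩
  | @comp A B E f g hf hg ihf ihg =>
    obtain ⟨_, _, m₁, l₁, r₁, h₁, hl₁, hr₁, e₁⟩ := ihg h
    obtain ⟨_, _, m₂, l₂, r₂, h₂, hl₂, hr₂, e₂⟩ := ihf h₁
    refine ⟨_, _, m₂, _, _, h₂, hl₂.comp hl₁, hr₂.comp hr₁, ?_⟩
    rw [Category.assoc, e₁, ← Category.assoc, e₂, Category.assoc, L.paHom_comp]
  | @otHom A A' B B' f g hf hg ihf ihg =>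
    cases h with
    | dl _ h =>
      obtain ⟨_, _, m₁, l₁, r₁, h₁, hl₁, hr₁, e₁⟩ := ihg h
      exact ⟨_, _, _, _, _, .dl _ h₁, hf.otHom hl₁, hr₁, L.otHom_dl e₁⟩
    | dr _ h =>
      obtain ⟨_, _, m₁, l₁, r₁, h₁, hl₁, hr₁, e₁⟩ := ihf h
      exact ⟨_, _, _, _, _, .dr _ h₁, hl₁, hr₁.otHom hg, L.otHom_dr e₁⟩
  | @paHom A A' B B' f g hf hg ihf ihg =>
    cases h with
    | here =>
      exact ⟨_, _, _, _, _, .here _ _, hf, hg,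
        (Category.comp_id (L.paHom f g)).trans (Category.id_comp _).symm⟩
    | left _ h =>
      obtain ⟨_, _, m₁, l₁, r₁, h₁, hl₁, hr₁, e₁⟩ := ihg h
      exact ⟨_, _, _, _, _, .left _ h₁, hf.paHom hl₁, hr₁, M.hom_left e₁⟩
    | right _ h =>
      obtain ⟨_, _, m₁, l₁, r₁, h₁, hl₁, hr₁, e₁⟩ := ihf h
      exact ⟨_, _, _, _, _, .right _ h₁, hl₁, hr₁.paHom hg, M.hom_right e₁⟩
  | α A B E =>
    cases h with
    | dl _ h => exact ⟨_, _, _, _, _, .dl _ (.dl _ h), .α _ _ _, .id _, L.α_dl _ _ _⟩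
    | @dr _ _ _ R _ h =>
      cases h with
      | @dl _ _ V _ _ h =>
        exact ⟨_, _, _, _, _, .dl _ (.dr _ h), .id (ot A V), .id (ot R E), L.α_dr_dl _ _ _⟩
      | dr _ h => exact ⟨_, _, _, _, _, .dr _ h, .id _, .α _ _ _, L.α_dr_dr _ _ _⟩
  | αInv A B E =>
    cases h with
    | dr _ h =>
      exact ⟨_, _, _, _, _, .dr _ (.dr _ h), .id _, .αInv _ _ _,
        inv_square (L.α_dr_dr _ _ _) (L.αInv_α _ _ _) (M.id_hom_inv (L.α_αInv _ _ _))⟩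
    | @dl _ _ U _ _ h =>
      cases h with
      | dl _ h =>
        exact ⟨_, _, _, _, _, .dl _ h, .αInv _ _ _, .id _,
          inv_square (L.α_dl _ _ _) (L.αInv_α _ _ _) (M.hom_id_inv (L.α_αInv _ _ _))⟩
      | @dr _ _ _ W _ h =>
        exact ⟨_, _, _, _, _, .dr _ (.dl _ h), .id (ot A U), .id (ot W E),
          inv_square (L.α_dr_dl _ _ _) (L.αInv_α _ _ _) (M.id_hom_inv (Category.comp_id _))⟩
  | pα A B E =>
    cases h with
    | here => exact ⟨_, _, _, _, _, .left _ (.here _ _), .id (pa A B), .id _, M.α_here _ _ _⟩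
    | left _ h => exact ⟨_, _, _, _, _, .left _ (.left _ h), .pα _ _ _, .id _, M.α_left _ _ _⟩
    | @right _ _ _ R _ h =>
      cases h with
      | here => exact ⟨_, _, _, _, _, .here _ _, .id _, .id (pa B E), M.α_right_here _ _ _⟩
      | @left _ _ V _ _ h =>
        exact ⟨_, _, _, _, _, .left _ (.right _ h), .id (pa A V), .id (pa R E),
          M.α_right_left _ _ _⟩
      | right _ h =>
        exact ⟨_, _, _, _, _, .right _ h, .id _, .pα _ _ _, M.α_right_right _ _ _⟩
  | pαInv A B E =>
    cases h with
    | here =>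
      exact ⟨_, _, _, _, _, .right _ (.here _ _), .id _, .id (pa B E),
        inv_square (M.α_right_here _ _ _) (M.αInv_α _ _ _) (M.id_hom_inv (Category.comp_id _))⟩
    | right _ h =>
      exact ⟨_, _, _, _, _, .right _ (.right _ h), .id _, .pαInv _ _ _,
        inv_square (M.α_right_right _ _ _) (M.αInv_α _ _ _) (M.id_hom_inv (M.α_αInv _ _ _))⟩
    | @left _ _ U _ _ h =>
      cases h with
      | here =>
        exact ⟨_, _, _, _, _, .here _ _, .id (pa A B), .id _,
          inv_square (M.α_here _ _ _) (M.αInv_α _ _ _) (M.id_hom_inv (Category.comp_id _))⟩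
      | left _ h =>
        exact ⟨_, _, _, _, _, .left _ h, .pαInv _ _ _, .id _,
          inv_square (M.α_left _ _ _) (M.αInv_α _ _ _) (M.hom_id_inv (M.α_αInv _ _ _))⟩
      | @right _ _ _ W _ h =>
        exact ⟨_, _, _, _, _, .right _ (.left _ h), .id (pa A U), .id (pa W E),
          inv_square (M.α_right_left _ _ _) (M.αInv_α _ _ _) (M.id_hom_inv (Category.comp_id _))⟩
  | δl A B E =>
    cases h with
    | here => exact ⟨_, _, _, _, _, .dl _ (.here _ _), .id (ot A B), .id _, L.δl_here _ _ _⟩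
    | left _ h => exact ⟨_, _, _, _, _, .dl _ (.left _ h), .δl _ _ _, .id _, L.δl_left _ _ _⟩
    | @right _ _ _ R _ h =>
      cases h with
      | @dl _ _ V _ _ h =>
        exact ⟨_, _, _, _, _, .dl _ (.right _ h), .id (ot A V), .id (pa R E),
          L.δl_right_dl _ _ _⟩
      | dr _ h => exact ⟨_, _, _, _, _, .dr _ h, .id _, .δl _ _ _, L.δl_right_dr _ _ _⟩
  | δr A B E =>
    cases h with
    | here => exact ⟨_, _, _, _, _, .dr _ (.here _ _), .id _, .id (ot B E), L.δr_here _ _ _⟩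
    | right _ h => exact ⟨_, _, _, _, _, .dr _ (.right _ h), .id _, .δr _ _ _, L.δr_right _ _ _⟩
    | @left _ _ U _ _ h =>
      cases h with
      | dl _ h => exact ⟨_, _, _, _, _, .dl _ h, .δr _ _ _, .id _, L.δr_left_dl _ _ _⟩
      | @dr _ _ _ W _ h =>
        exact ⟨_, _, _, _, _, .dr _ (.left _ h), .id (pa A U), .id (ot W E),
          L.δr_left_dr _ _ _⟩

end PaSplit

/-- Parallel definable morphisms are equal. -/
theorem Definable.eq {P Q : Formula S} {f g : val L η P ⟶ val L η Q}
    (hf : Definable L η f) (hg : Definable L η g) : f = g := by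
  induction Q generalizing P with
  | var s =>
    obtain ⟨rfl, rfl⟩ := hf.eq_of_size_eq_one hf.size_eq
    obtain ⟨_, rfl⟩ := hg.eq_of_size_eq_one rfl
    rfl
  | ot Q₁ Q₂ ih₁ ih₂ =>
    obtain ⟨_, _, m, l, r, h, hl, hr, e⟩ := OtSplit.lift hf (.here Q₁ Q₂)
    obtain ⟨_, _, m', l', r', h', hl', hr', e'⟩ := OtSplit.lift hg (.here Q₁ Q₂)
    obtain ⟨rfl, rfl, hm⟩ := h.unique h' (hl.size_eq.trans hl'.size_eq.symm)
    cases hm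
    obtain rfl := ih₁ hl hl'
    obtain rfl := ih₂ hr hr'
    exact (Category.comp_id f).symm.trans ((e.trans e'.symm).trans (Category.comp_id g))
  | pa Q₁ Q₂ ih₁ ih₂ =>
    obtain ⟨_, _, m, l, r, h, hl, hr, e⟩ := PaSplit.lift hf (.here Q₁ Q₂)
    obtain ⟨_, _, m', l', r', h', hl', hr', e'⟩ := PaSplit.lift hg (.here Q₁ Q₂)
    obtain ⟨rfl, rfl, hm⟩ := h.unique h' (hl.size_eq.trans hl'.size_eq.symm)
    cases hm
    obtain rfl := ih₁ hl hl'
    obtain rfl := ih₂ hr hr'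
    exact (Category.comp_id f).symm.trans ((e.trans e'.symm).trans (Category.comp_id g))

/-! ### The category of formulas and definable morphisms -/

/-- Formulas in `S`, as the objects of the category of definable morphisms of `L` at `η`. -/
structure DefinableCat (L : LD C) (η : S → C) where
  /-- The underlying formula. -/
  formula : Formula S

namespace DefinableCat

instance : Category (DefinableCat L η) where
  Hom A B := { f : val L η A.formula ⟶ val L η B.formula // Definable L η f }
  id _ := ⟨𝟙 _, .id _⟩
  comp f g := ⟨f.1 ≫ g.1, f.2.comp g.2⟩
  id_comp f := Subtype.ext (Category.id_comp f.1)
  comp_id f := Subtype.ext (Category.comp_id f.1)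
  assoc f g h := Subtype.ext (Category.assoc f.1 g.1 h.1)

lemma hom_eq {A B : DefinableCat L η} (f g : A ⟶ B) : f = g :=
  Subtype.ext (f.2.eq g.2)

/-- The linearly distributive structure inherited from `L`. -/
def ld (L : LD C) (η : S → C) : LD (DefinableCat L η) where
  ot A B := ⟨ot A.formula B.formula⟩
  pa A B := ⟨pa A.formula B.formula⟩
  otHom f g := ⟨L.otHom f.1 g.1, f.2.otHom g.2⟩
  paHom f g := ⟨L.paHom f.1 g.1, f.2.paHom g.2⟩
  α A B E := ⟨L.α _ _ _, .α A.formula B.formula E.formula⟩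
  αInv A B E := ⟨L.αInv _ _ _, .αInv A.formula B.formula E.formula⟩
  pα A B E := ⟨L.pα _ _ _, .pα A.formula B.formula E.formula⟩
  pαInv A B E := ⟨L.pαInv _ _ _, .pαInv A.formula B.formula E.formula⟩
  δl A B E := ⟨L.δl _ _ _, .δl A.formula B.formula E.formula⟩
  δr A B E := ⟨L.δr _ _ _, .δr A.formula B.formula E.formula⟩
  otHom_id _ _ := hom_eq _ _
  otHom_comp _ _ _ _ := hom_eq _ _
  paHom_id _ _ := hom_eq _ _
  paHom_comp _ _ _ _ := hom_eq _ _
  α_αInv _ _ _ := hom_eq _ _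
  αInv_α _ _ _ := hom_eq _ _
  pα_pαInv _ _ _ := hom_eq _ _
  pαInv_pα _ _ _ := hom_eq _ _
  α_natural _ _ _ := hom_eq _ _
  pα_natural _ _ _ := hom_eq _ _
  δl_natural _ _ _ := hom_eq _ _
  δr_natural _ _ _ := hom_eq _ _
  P1 _ _ _ _ := hom_eq _ _
  P2 _ _ _ _ := hom_eq _ _
  P3 _ _ _ _ := hom_eq _ _
  P4 _ _ _ _ := hom_eq _ _
  P5 _ _ _ _ := hom_eq _ _
  P6 _ _ _ _ := hom_eq _ _
  P7 _ _ _ _ := hom_eq _ _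
  P8 _ _ _ _ := hom_eq _ _

/-- Evaluation of formulas and definable morphisms in the ambient category. -/
def forget (L : LD C) (η : S → C) : DefinableCat L η ⥤ C where
  obj A := val L η A.formula
  map f := f.1

/-- The composite of a strict functor into `DefinableCat` with evaluation is strict. -/
def compForget (L : LD C) (η : S → C) (G : StrictLDFunctor Cc (DefinableCat L η) LC (ld L η)) :
    StrictLDFunctor Cc C LC L where
  toFunctor := G.toFunctor ⋙ forget L η
  obj_ot X Y := congrArg (forget L η).obj (G.obj_ot X Y)
  obj_pa X Y := congrArg (forget L η).obj (G.obj_pa X Y)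
  map_ot f g := by
    rw [Functor.comp_map, G.map_ot, Functor.map_comp, Functor.map_comp, eqToHom_map, eqToHom_map]
    rfl
  map_pa f g := by
    rw [Functor.comp_map, G.map_pa, Functor.map_comp, Functor.map_comp, eqToHom_map, eqToHom_map]
    rfl
  map_α A B E := by
    rw [Functor.comp_map, G.map_α, Functor.map_comp, Functor.map_comp, eqToHom_map, eqToHom_map]
    rfl
  map_αInv A B E := by
    rw [Functor.comp_map, G.map_αInv, Functor.map_comp, Functor.map_comp, eqToHom_map, eqToHom_map]
    rfl
  map_pα A B E := by
    rw [Functor.comp_map, G.map_pα, Functor.map_comp, Functor.map_comp, eqToHom_map, eqToHom_map]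
    rfl
  map_pαInv A B E := by
    rw [Functor.comp_map, G.map_pαInv, Functor.map_comp, Functor.map_comp, eqToHom_map, eqToHom_map]
    rfl
  map_δl A B E := by
    rw [Functor.comp_map, G.map_δl, Functor.map_comp, Functor.map_comp, eqToHom_map, eqToHom_map]
    rfl
  map_δr A B E := by
    rw [Functor.comp_map, G.map_δr, Functor.map_comp, Functor.map_comp, eqToHom_map, eqToHom_map]
    rfl

end DefinableCat

/-- The identity functor as a strict functor. -/
def StrictLDFunctor.refl (L : LD C) : StrictLDFunctor C C L L where
  toFunctor := 𝟭 C
  obj_ot _ _ := rfl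
  obj_pa _ _ := rfl
  map_ot _ _ := by simp
  map_pa _ _ := by simp
  map_α _ _ _ := by simp
  map_αInv _ _ _ := by simp
  map_pα _ _ _ := by simp
  map_pαInv _ _ _ := by simp
  map_δl _ _ _ := by simp
  map_δr _ _ _ := by simp

/-- **Coherence theorem for unitless linearly distributive categories**:
the free unitless LD category on a set `S` is thin. -/
theorem free_unitless_LD_category_is_thin
    (S : Type) (F : Type) [Category.{0} F] (LF : LD F) (η : S → F)
    (hfree : ∀ (E : Type) [instE : Category.{0} E] (LE : LD E) (f : S → E),
      ∃ G : StrictLDFunctor F E LF LE,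
        (∀ s : S, G.toFunctor.obj (η s) = f s) ∧
        ∀ G' : StrictLDFunctor F E LF LE,
          (∀ s : S, G'.toFunctor.obj (η s) = f s) → G'.toFunctor = G.toFunctor) :
    ∀ (X Y : F) (g h : X ⟶ Y), g = h := by
  obtain ⟨G, hG, -⟩ := hfree (DefinableCat LF η) (DefinableCat.ld LF η) fun s => ⟨.var s⟩
  obtain ⟨G₀, -, huniq⟩ := hfree F LF η
  have hid : G.toFunctor ⋙ DefinableCat.forget LF η = 𝟭 F :=
    (huniq (DefinableCat.compForget LF η G) fun s =>
      congrArg (DefinableCat.forget LF η).obj (hG s)).trans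
      (huniq (StrictLDFunctor.refl LF) fun _ => rfl).symm
  intro X Y g h
  have hgh : (G.toFunctor ⋙ DefinableCat.forget LF η).map g =
      (G.toFunctor ⋙ DefinableCat.forget LF η).map h :=
    congrArg (DefinableCat.forget LF η).map (DefinableCat.hom_eq _ _)
  rw [hid] at hgh
  exact hgh

end LDCoherence
end

section
/- Coherence theorem for Frobenius linearly distributive functors: the target category of the free unitless Frobenius LD functor on any type S is thin. Precisely, let F_S : C_S → D_S be a Frobenius LD functor together with a function η : S → Ob(C_S) satisfying the universal property of the free Frobenius LD functor on S; then for all objects X, Y of D_S there is at most one morphism X → Y. -/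
open CategoryTheory

namespace LDCoherence

universe v u v₁ u₁ v₂ u₂

variable {C : Type u} [Category.{v} C]

variable {Cc : Type u₁} [Category.{v₁} Cc] {Dd : Type u₂} [Category.{v₂} Dd]
  {LC : LD Cc} {LDd : LD Dd}

universe w

@[simp]
theorem LD.id_otHom_comp (L : LD C) (A : C) {X Y Z : C} (f : X ⟶ Y) (g : Y ⟶ Z) :
    L.otHom (𝟙 A) (f ≫ g) = L.otHom (𝟙 A) f ≫ L.otHom (𝟙 A) g := by
  rw [← L.otHom_comp, Category.id_comp]

@[simp]
theorem LD.otHom_comp_id_s2 (L : LD C) (A : C) {X Y Z : C} (f : X ⟶ Y) (g : Y ⟶ Z) :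
    L.otHom (f ≫ g) (𝟙 A) = L.otHom f (𝟙 A) ≫ L.otHom g (𝟙 A) := by
  rw [← L.otHom_comp, Category.id_comp]

@[simp]
theorem LD.id_paHom_comp (L : LD C) (A : C) {X Y Z : C} (f : X ⟶ Y) (g : Y ⟶ Z) :
    L.paHom (𝟙 A) (f ≫ g) = L.paHom (𝟙 A) f ≫ L.paHom (𝟙 A) g := by
  rw [← L.paHom_comp, Category.id_comp]

@[simp]
theorem LD.paHom_comp_id_s2 (L : LD C) (A : C) {X Y Z : C} (f : X ⟶ Y) (g : Y ⟶ Z) :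
    L.paHom (f ≫ g) (𝟙 A) = L.paHom f (𝟙 A) ≫ L.paHom g (𝟙 A) := by
  rw [← L.paHom_comp, Category.id_comp]

theorem LD.αInv_natural (L : LD C) {A A' B B' E E' : C}
    (f : A ⟶ A') (g : B ⟶ B') (h : E ⟶ E') :
    L.otHom (L.otHom f g) h ≫ L.αInv A' B' E' = L.αInv A B E ≫ L.otHom f (L.otHom g h) := by
  rw [← Category.id_comp (L.otHom (L.otHom f g) h), ← L.αInv_α, Category.assoc, Category.assoc,
    ← reassoc_of% (L.α_natural f g h), L.α_αInv, Category.comp_id]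

theorem LD.pαInv_natural (L : LD C) {A A' B B' E E' : C}
    (f : A ⟶ A') (g : B ⟶ B') (h : E ⟶ E') :
    L.paHom (L.paHom f g) h ≫ L.pαInv A' B' E' = L.pαInv A B E ≫ L.paHom f (L.paHom g h) := by
  rw [← Category.id_comp (L.paHom (L.paHom f g) h), ← L.pαInv_pα, Category.assoc, Category.assoc,
    ← reassoc_of% (L.pα_natural f g h), L.pα_pαInv, Category.comp_id]

@[simp]
theorem LD.α_comp (L : LD C) {A A' B B' E E' : C} (f : A ⟶ A') (g : B ⟶ B') (h : E ⟶ E') :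
    L.α A B E ≫ L.otHom (L.otHom f g) h = L.otHom f (L.otHom g h) ≫ L.α A' B' E' :=
  (L.α_natural f g h).symm

@[simp]
theorem LD.α_comp_assoc (L : LD C) {A A' B B' E E' Z : C} (f : A ⟶ A') (g : B ⟶ B')
    (h : E ⟶ E') (k : L.ot (L.ot A' B') E' ⟶ Z) :
    L.α A B E ≫ L.otHom (L.otHom f g) h ≫ k = L.otHom f (L.otHom g h) ≫ L.α A' B' E' ≫ k := by
  simp only [← Category.assoc, L.α_comp]

@[simp]
theorem LD.α_comp_right (L : LD C) {A B E E' : C} (h : E ⟶ E') :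
    L.α A B E ≫ L.otHom (𝟙 (L.ot A B)) h =
      L.otHom (𝟙 A) (L.otHom (𝟙 B) h) ≫ L.α A B E' := by
  rw [← L.otHom_id, L.α_comp]

@[simp]
theorem LD.α_comp_right_assoc (L : LD C) {A B E E' Z : C} (h : E ⟶ E')
    (k : L.ot (L.ot A B) E' ⟶ Z) :
    L.α A B E ≫ L.otHom (𝟙 (L.ot A B)) h ≫ k =
      L.otHom (𝟙 A) (L.otHom (𝟙 B) h) ≫ L.α A B E' ≫ k := by
  simp only [← Category.assoc, L.α_comp_right]

@[simp]
theorem LD.αInv_comp (L : LD C) {A A' B B' E E' : C} (f : A ⟶ A') (g : B ⟶ B') (h : E ⟶ E') :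
    L.αInv A B E ≫ L.otHom f (L.otHom g h) = L.otHom (L.otHom f g) h ≫ L.αInv A' B' E' :=
  (L.αInv_natural f g h).symm

@[simp]
theorem LD.αInv_comp_assoc (L : LD C) {A A' B B' E E' Z : C} (f : A ⟶ A') (g : B ⟶ B')
    (h : E ⟶ E') (k : L.ot A' (L.ot B' E') ⟶ Z) :
    L.αInv A B E ≫ L.otHom f (L.otHom g h) ≫ k = L.otHom (L.otHom f g) h ≫ L.αInv A' B' E' ≫ k := by
  simp only [← Category.assoc, L.αInv_comp]

@[simp]
theorem LD.αInv_comp_left (L : LD C) {A B E A' : C} (f : A ⟶ A') :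
    L.αInv A B E ≫ L.otHom f (𝟙 (L.ot B E)) =
      L.otHom (L.otHom f (𝟙 B)) (𝟙 E) ≫ L.αInv A' B E := by
  rw [← L.otHom_id, L.αInv_comp]

@[simp]
theorem LD.αInv_comp_left_assoc (L : LD C) {A B E A' Z : C} (f : A ⟶ A')
    (k : L.ot A' (L.ot B E) ⟶ Z) :
    L.αInv A B E ≫ L.otHom f (𝟙 (L.ot B E)) ≫ k =
      L.otHom (L.otHom f (𝟙 B)) (𝟙 E) ≫ L.αInv A' B E ≫ k := by
  simp only [← Category.assoc, L.αInv_comp_left]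

@[simp]
theorem LD.pα_comp (L : LD C) {A A' B B' E E' : C} (f : A ⟶ A') (g : B ⟶ B') (h : E ⟶ E') :
    L.pα A B E ≫ L.paHom (L.paHom f g) h = L.paHom f (L.paHom g h) ≫ L.pα A' B' E' :=
  (L.pα_natural f g h).symm

@[simp]
theorem LD.pα_comp_assoc (L : LD C) {A A' B B' E E' Z : C} (f : A ⟶ A') (g : B ⟶ B')
    (h : E ⟶ E') (k : L.pa (L.pa A' B') E' ⟶ Z) :
    L.pα A B E ≫ L.paHom (L.paHom f g) h ≫ k = L.paHom f (L.paHom g h) ≫ L.pα A' B' E' ≫ k := by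
  simp only [← Category.assoc, L.pα_comp]

@[simp]
theorem LD.pα_comp_right (L : LD C) {A B E E' : C} (h : E ⟶ E') :
    L.pα A B E ≫ L.paHom (𝟙 (L.pa A B)) h =
      L.paHom (𝟙 A) (L.paHom (𝟙 B) h) ≫ L.pα A B E' := by
  rw [← L.paHom_id, L.pα_comp]

@[simp]
theorem LD.pα_comp_right_assoc (L : LD C) {A B E E' Z : C} (h : E ⟶ E')
    (k : L.pa (L.pa A B) E' ⟶ Z) :
    L.pα A B E ≫ L.paHom (𝟙 (L.pa A B)) h ≫ k =
      L.paHom (𝟙 A) (L.paHom (𝟙 B) h) ≫ L.pα A B E' ≫ k := by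
  simp only [← Category.assoc, L.pα_comp_right]

@[simp]
theorem LD.pαInv_comp (L : LD C) {A A' B B' E E' : C} (f : A ⟶ A') (g : B ⟶ B') (h : E ⟶ E') :
    L.pαInv A B E ≫ L.paHom f (L.paHom g h) = L.paHom (L.paHom f g) h ≫ L.pαInv A' B' E' :=
  (L.pαInv_natural f g h).symm

@[simp]
theorem LD.pαInv_comp_assoc (L : LD C) {A A' B B' E E' Z : C} (f : A ⟶ A') (g : B ⟶ B')
    (h : E ⟶ E') (k : L.pa A' (L.pa B' E') ⟶ Z) :
    L.pαInv A B E ≫ L.paHom f (L.paHom g h) ≫ k =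
      L.paHom (L.paHom f g) h ≫ L.pαInv A' B' E' ≫ k := by
  simp only [← Category.assoc, L.pαInv_comp]

@[simp]
theorem LD.pαInv_comp_left (L : LD C) {A B E A' : C} (f : A ⟶ A') :
    L.pαInv A B E ≫ L.paHom f (𝟙 (L.pa B E)) =
      L.paHom (L.paHom f (𝟙 B)) (𝟙 E) ≫ L.pαInv A' B E := by
  rw [← L.paHom_id, L.pαInv_comp]

@[simp]
theorem LD.pαInv_comp_left_assoc (L : LD C) {A B E A' Z : C} (f : A ⟶ A')
    (k : L.pa A' (L.pa B E) ⟶ Z) :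
    L.pαInv A B E ≫ L.paHom f (𝟙 (L.pa B E)) ≫ k =
      L.paHom (L.paHom f (𝟙 B)) (𝟙 E) ≫ L.pαInv A' B E ≫ k := by
  simp only [← Category.assoc, L.pαInv_comp_left]

@[simp]
theorem LD.δl_comp (L : LD C) {A A' B B' E E' : C} (f : A ⟶ A') (g : B ⟶ B') (h : E ⟶ E') :
    L.δl A B E ≫ L.paHom (L.otHom f g) h = L.otHom f (L.paHom g h) ≫ L.δl A' B' E' :=
  (L.δl_natural f g h).symm

@[simp]
theorem LD.δl_comp_assoc (L : LD C) {A A' B B' E E' Z : C} (f : A ⟶ A') (g : B ⟶ B')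
    (h : E ⟶ E') (k : L.pa (L.ot A' B') E' ⟶ Z) :
    L.δl A B E ≫ L.paHom (L.otHom f g) h ≫ k = L.otHom f (L.paHom g h) ≫ L.δl A' B' E' ≫ k := by
  simp only [← Category.assoc, L.δl_comp]

@[simp]
theorem LD.δl_comp_right (L : LD C) {A B E E' : C} (h : E ⟶ E') :
    L.δl A B E ≫ L.paHom (𝟙 (L.ot A B)) h =
      L.otHom (𝟙 A) (L.paHom (𝟙 B) h) ≫ L.δl A B E' := by
  rw [← L.otHom_id, L.δl_comp]

@[simp]
theorem LD.δl_comp_right_assoc (L : LD C) {A B E E' Z : C} (h : E ⟶ E')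
    (k : L.pa (L.ot A B) E' ⟶ Z) :
    L.δl A B E ≫ L.paHom (𝟙 (L.ot A B)) h ≫ k =
      L.otHom (𝟙 A) (L.paHom (𝟙 B) h) ≫ L.δl A B E' ≫ k := by
  simp only [← Category.assoc, L.δl_comp_right]

@[simp]
theorem LD.δr_comp (L : LD C) {A A' B B' E E' : C} (f : A ⟶ A') (g : B ⟶ B') (h : E ⟶ E') :
    L.δr A B E ≫ L.paHom f (L.otHom g h) = L.otHom (L.paHom f g) h ≫ L.δr A' B' E' :=
  (L.δr_natural f g h).symm

@[simp]
theorem LD.δr_comp_assoc (L : LD C) {A A' B B' E E' Z : C} (f : A ⟶ A') (g : B ⟶ B')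
    (h : E ⟶ E') (k : L.pa A' (L.ot B' E') ⟶ Z) :
    L.δr A B E ≫ L.paHom f (L.otHom g h) ≫ k = L.otHom (L.paHom f g) h ≫ L.δr A' B' E' ≫ k := by
  simp only [← Category.assoc, L.δr_comp]

@[simp]
theorem LD.δr_comp_left (L : LD C) {A B E A' : C} (f : A ⟶ A') :
    L.δr A B E ≫ L.paHom f (𝟙 (L.ot B E)) =
      L.otHom (L.paHom f (𝟙 B)) (𝟙 E) ≫ L.δr A' B E := by
  rw [← L.otHom_id, L.δr_comp]

@[simp]
theorem LD.δr_comp_left_assoc (L : LD C) {A B E A' Z : C} (f : A ⟶ A')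
    (k : L.pa A' (L.ot B E) ⟶ Z) :
    L.δr A B E ≫ L.paHom f (𝟙 (L.ot B E)) ≫ k =
      L.otHom (L.paHom f (𝟙 B)) (𝟙 E) ≫ L.δr A' B E ≫ k := by
  simp only [← Category.assoc, L.δr_comp_left]

@[simp]
theorem LD.otHom_exchange (L : LD C) {A A' B B' : C} (f : A ⟶ A') (g : B ⟶ B') :
    L.otHom (𝟙 A) g ≫ L.otHom f (𝟙 B') = L.otHom f (𝟙 B) ≫ L.otHom (𝟙 A') g := by
  simp only [← L.otHom_comp, Category.id_comp, Category.comp_id]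

@[simp]
theorem LD.otHom_exchange_assoc (L : LD C) {A A' B B' Z : C} (f : A ⟶ A') (g : B ⟶ B')
    (k : L.ot A' B' ⟶ Z) :
    L.otHom (𝟙 A) g ≫ L.otHom f (𝟙 B') ≫ k =
      L.otHom f (𝟙 B) ≫ L.otHom (𝟙 A') g ≫ k := by
  simp only [← Category.assoc, L.otHom_exchange]

@[simp]
theorem LD.paHom_exchange (L : LD C) {A A' B B' : C} (f : A ⟶ A') (g : B ⟶ B') :
    L.paHom (𝟙 A) g ≫ L.paHom f (𝟙 B') = L.paHom f (𝟙 B) ≫ L.paHom (𝟙 A') g := by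
  simp only [← L.paHom_comp, Category.id_comp, Category.comp_id]

@[simp]
theorem LD.paHom_exchange_assoc (L : LD C) {A A' B B' Z : C} (f : A ⟶ A') (g : B ⟶ B')
    (k : L.pa A' B' ⟶ Z) :
    L.paHom (𝟙 A) g ≫ L.paHom f (𝟙 B') ≫ k =
      L.paHom f (𝟙 B) ≫ L.paHom (𝟙 A') g ≫ k := by
  simp only [← Category.assoc, L.paHom_exchange]

@[simp]
theorem LD.α_αInv_assoc (L : LD C) {A B E Z : C} (k : L.ot A (L.ot B E) ⟶ Z) :
    L.α A B E ≫ L.αInv A B E ≫ k = k :=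
  (reassoc_of% (L.α_αInv A B E)) k

@[simp]
theorem LD.αInv_α_assoc (L : LD C) {A B E Z : C} (k : L.ot (L.ot A B) E ⟶ Z) :
    L.αInv A B E ≫ L.α A B E ≫ k = k :=
  (reassoc_of% (L.αInv_α A B E)) k

@[simp]
theorem LD.pα_pαInv_assoc (L : LD C) {A B E Z : C} (k : L.pa A (L.pa B E) ⟶ Z) :
    L.pα A B E ≫ L.pαInv A B E ≫ k = k :=
  (reassoc_of% (L.pα_pαInv A B E)) k

@[simp]
theorem LD.pαInv_pα_assoc (L : LD C) {A B E Z : C} (k : L.pa (L.pa A B) E ⟶ Z) :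
    L.pαInv A B E ≫ L.pα A B E ≫ k = k :=
  (reassoc_of% (L.pαInv_pα A B E)) k

attribute [simp] LD.otHom_id LD.paHom_id LD.α_αInv LD.αInv_α LD.pα_pαInv LD.pαInv_pα

theorem LD.id_otHom_cancel (L : LD C) (A : C) {X Y : C} {f : X ⟶ Y} {g : Y ⟶ X}
    (h : f ≫ g = 𝟙 X) : L.otHom (𝟙 A) f ≫ L.otHom (𝟙 A) g = 𝟙 _ := by
  rw [← L.id_otHom_comp, h, L.otHom_id]

theorem LD.id_otHom_cancel_assoc (L : LD C) (A : C) {X Y Z : C} {f : X ⟶ Y} {g : Y ⟶ X}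
    (h : f ≫ g = 𝟙 X) (k : L.ot A X ⟶ Z) :
    L.otHom (𝟙 A) f ≫ L.otHom (𝟙 A) g ≫ k = k := by
  rw [reassoc_of% (L.id_otHom_cancel A h)]

theorem LD.otHom_id_cancel (L : LD C) (A : C) {X Y : C} {f : X ⟶ Y} {g : Y ⟶ X}
    (h : f ≫ g = 𝟙 X) : L.otHom f (𝟙 A) ≫ L.otHom g (𝟙 A) = 𝟙 _ := by
  rw [← L.otHom_comp_id_s2, h, L.otHom_id]

theorem LD.otHom_id_cancel_assoc (L : LD C) (A : C) {X Y Z : C} {f : X ⟶ Y} {g : Y ⟶ X}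
    (h : f ≫ g = 𝟙 X) (k : L.ot X A ⟶ Z) :
    L.otHom f (𝟙 A) ≫ L.otHom g (𝟙 A) ≫ k = k := by
  rw [reassoc_of% (L.otHom_id_cancel A h)]

theorem LD.id_paHom_cancel (L : LD C) (A : C) {X Y : C} {f : X ⟶ Y} {g : Y ⟶ X}
    (h : f ≫ g = 𝟙 X) : L.paHom (𝟙 A) f ≫ L.paHom (𝟙 A) g = 𝟙 _ := by
  rw [← L.id_paHom_comp, h, L.paHom_id]

theorem LD.id_paHom_cancel_assoc (L : LD C) (A : C) {X Y Z : C} {f : X ⟶ Y} {g : Y ⟶ X}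
    (h : f ≫ g = 𝟙 X) (k : L.pa A X ⟶ Z) :
    L.paHom (𝟙 A) f ≫ L.paHom (𝟙 A) g ≫ k = k := by
  rw [reassoc_of% (L.id_paHom_cancel A h)]

theorem LD.paHom_id_cancel (L : LD C) (A : C) {X Y : C} {f : X ⟶ Y} {g : Y ⟶ X}
    (h : f ≫ g = 𝟙 X) : L.paHom f (𝟙 A) ≫ L.paHom g (𝟙 A) = 𝟙 _ := by
  rw [← L.paHom_comp_id_s2, h, L.paHom_id]

theorem LD.paHom_id_cancel_assoc (L : LD C) (A : C) {X Y Z : C} {f : X ⟶ Y} {g : Y ⟶ X}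
    (h : f ≫ g = 𝟙 X) (k : L.pa X A ⟶ Z) :
    L.paHom f (𝟙 A) ≫ L.paHom g (𝟙 A) ≫ k = k := by
  rw [reassoc_of% (L.paHom_id_cancel A h)]

theorem LD.P1_inv_left (L : LD C) (A B E D : C) :
    L.αInv A B (L.ot E D) ≫ L.otHom (𝟙 A) (L.α B E D) ≫ L.α A (L.ot B E) D =
      L.α (L.ot A B) E D ≫ L.otHom (L.αInv A B E) (𝟙 D) := by
  have h := congrArg (fun k => L.αInv A B (L.ot E D) ≫ k ≫ L.otHom (L.αInv A B E) (𝟙 D))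
    (L.P1 A B E D)
  simpa [L.id_otHom_cancel, L.id_otHom_cancel_assoc, L.otHom_id_cancel,
    L.otHom_id_cancel_assoc] using h.symm

theorem LD.P1_inv_mid (L : LD C) (A B E D : C) :
    L.αInv A (L.ot B E) D ≫ L.otHom (𝟙 A) (L.αInv B E D) ≫ L.α A B (L.ot E D) =
      L.otHom (L.α A B E) (𝟙 D) ≫ L.αInv (L.ot A B) E D := by
  have h := congrArg (fun k => L.αInv A (L.ot B E) D ≫ L.otHom (𝟙 A) (L.αInv B E D) ≫ k ≫
    L.αInv (L.ot A B) E D) (L.P1 A B E D)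
  simpa [L.id_otHom_cancel, L.id_otHom_cancel_assoc, L.otHom_id_cancel,
    L.otHom_id_cancel_assoc] using h

theorem LD.P1_inv (L : LD C) (A B E D : C) :
    L.αInv (L.ot A B) E D ≫ L.αInv A B (L.ot E D) =
      L.otHom (L.αInv A B E) (𝟙 D) ≫ L.αInv A (L.ot B E) D ≫ L.otHom (𝟙 A) (L.αInv B E D) := by
  have h := congrArg (fun k => L.otHom (L.αInv A B E) (𝟙 D) ≫ k ≫ L.αInv A B (L.ot E D))
    (L.P1_inv_mid A B E D)
  simpa [L.id_otHom_cancel, L.id_otHom_cancel_assoc, L.otHom_id_cancel,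
    L.otHom_id_cancel_assoc] using h.symm

theorem LD.P1_inv_right (L : LD C) (A B E D : C) :
    L.α (L.ot A B) E D ≫ L.otHom (L.αInv A B E) (𝟙 D) ≫ L.αInv A (L.ot B E) D =
      L.αInv A B (L.ot E D) ≫ L.otHom (𝟙 A) (L.α B E D) := by
  simp [← reassoc_of% (L.P1_inv_left A B E D)]

theorem LD.P1_inv_outer (L : LD C) (A B E D : C) :
    L.α A (L.ot B E) D ≫ L.otHom (L.α A B E) (𝟙 D) ≫ L.αInv (L.ot A B) E D =
      L.otHom (𝟙 A) (L.αInv B E D) ≫ L.α A B (L.ot E D) := by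
  simp [← L.P1_inv_mid]

theorem LD.P8_inv_left (L : LD C) (A B E D : C) :
    L.pαInv A B (L.pa E D) ≫ L.paHom (𝟙 A) (L.pα B E D) ≫ L.pα A (L.pa B E) D =
      L.pα (L.pa A B) E D ≫ L.paHom (L.pαInv A B E) (𝟙 D) := by
  have h := congrArg (fun k => L.pαInv A B (L.pa E D) ≫ k ≫ L.paHom (L.pαInv A B E) (𝟙 D))
    (L.P8 A B E D)
  simpa [L.id_paHom_cancel, L.id_paHom_cancel_assoc, L.paHom_id_cancel,
    L.paHom_id_cancel_assoc] using h.symm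

theorem LD.P8_inv_mid (L : LD C) (A B E D : C) :
    L.pαInv A (L.pa B E) D ≫ L.paHom (𝟙 A) (L.pαInv B E D) ≫ L.pα A B (L.pa E D) =
      L.paHom (L.pα A B E) (𝟙 D) ≫ L.pαInv (L.pa A B) E D := by
  have h := congrArg (fun k => L.pαInv A (L.pa B E) D ≫ L.paHom (𝟙 A) (L.pαInv B E D) ≫ k ≫
    L.pαInv (L.pa A B) E D) (L.P8 A B E D)
  simpa [L.id_paHom_cancel, L.id_paHom_cancel_assoc, L.paHom_id_cancel,
    L.paHom_id_cancel_assoc] using h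

theorem LD.P8_inv (L : LD C) (A B E D : C) :
    L.pαInv (L.pa A B) E D ≫ L.pαInv A B (L.pa E D) =
      L.paHom (L.pαInv A B E) (𝟙 D) ≫ L.pαInv A (L.pa B E) D ≫ L.paHom (𝟙 A) (L.pαInv B E D) := by
  have h := congrArg (fun k => L.paHom (L.pαInv A B E) (𝟙 D) ≫ k ≫ L.pαInv A B (L.pa E D))
    (L.P8_inv_mid A B E D)
  simpa [L.id_paHom_cancel, L.id_paHom_cancel_assoc, L.paHom_id_cancel,
    L.paHom_id_cancel_assoc] using h.symm

theorem LD.P8_inv_right (L : LD C) (A B E D : C) :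
    L.pα (L.pa A B) E D ≫ L.paHom (L.pαInv A B E) (𝟙 D) ≫ L.pαInv A (L.pa B E) D =
      L.pαInv A B (L.pa E D) ≫ L.paHom (𝟙 A) (L.pα B E D) := by
  simp [← reassoc_of% (L.P8_inv_left A B E D)]

theorem LD.P8_inv_outer (L : LD C) (A B E D : C) :
    L.pα A (L.pa B E) D ≫ L.paHom (L.pα A B E) (𝟙 D) ≫ L.pαInv (L.pa A B) E D =
      L.paHom (𝟙 A) (L.pαInv B E D) ≫ L.pα A B (L.pa E D) := by
  simp [← L.P8_inv_mid]

theorem LD.P2_inv (L : LD C) (A B E D : C) :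
    L.αInv A B (L.pa E D) ≫ L.otHom (𝟙 A) (L.δl B E D) ≫ L.δl A (L.ot B E) D =
      L.δl (L.ot A B) E D ≫ L.paHom (L.αInv A B E) (𝟙 D) := by
  have h := congrArg (fun k => L.αInv A B (L.pa E D) ≫ k ≫ L.paHom (L.αInv A B E) (𝟙 D))
    (L.P2 A B E D)
  simpa [L.paHom_id_cancel] using h.symm

theorem LD.P4_inv (L : LD C) (A B E D : C) :
    L.δl A (L.pa B E) D ≫ L.paHom (L.δl A B E) (𝟙 D) ≫ L.pαInv (L.ot A B) E D =
      L.otHom (𝟙 A) (L.pαInv B E D) ≫ L.δl A B (L.pa E D) := by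
  have h := congrArg (fun k => L.otHom (𝟙 A) (L.pαInv B E D) ≫ k ≫ L.pαInv (L.ot A B) E D)
    (L.P4 A B E D)
  simpa [L.id_otHom_cancel_assoc] using h.symm

theorem LD.P5_inv (L : LD C) (A B E D : C) :
    L.αInv (L.pa A B) E D ≫ L.δr A B (L.ot E D) =
      L.otHom (L.δr A B E) (𝟙 D) ≫ L.δr A (L.ot B E) D ≫ L.paHom (𝟙 A) (L.αInv B E D) := by
  have h := congrArg (fun k => L.αInv (L.pa A B) E D ≫ k ≫ L.paHom (𝟙 A) (L.αInv B E D))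
    (L.P5 A B E D)
  simpa [L.id_paHom_cancel] using h

theorem LD.P6_inv (L : LD C) (A B E D : C) :
    L.δl (L.pa A B) E D ≫ L.paHom (L.δr A B E) (𝟙 D) ≫ L.pαInv A (L.ot B E) D =
      L.δr A B (L.pa E D) ≫ L.paHom (𝟙 A) (L.δl B E D) := by
  simp [reassoc_of% (L.P6 A B E D)]

theorem LD.P7_inv (L : LD C) (A B E D : C) :
    L.δr (L.pa A B) E D ≫ L.pαInv A B (L.ot E D) =
      L.otHom (L.pαInv A B E) (𝟙 D) ≫ L.δr A (L.pa B E) D ≫ L.paHom (𝟙 A) (L.δr B E D) := by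
  have h := congrArg (fun k => L.otHom (L.pαInv A B E) (𝟙 D) ≫ k ≫ L.pαInv A B (L.ot E D))
    (L.P7 A B E D)
  simpa [L.otHom_id_cancel_assoc] using h

/-- Formal `⊗`/`⅋`-expressions in the atoms `K`. -/
inductive Tree (K : Type w) : Type w
  | atom : K → Tree K
  | ot : Tree K → Tree K → Tree K
  | pa : Tree K → Tree K → Tree K

/-- The total weight of the atoms of a formal expression. -/
def Tree.size {K : Type w} (wt : K → ℕ) : Tree K → ℕ
  | .atom k => wt k
  | .ot X Y => X.size wt + Y.size wt
  | .pa X Y => X.size wt + Y.size wt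

/-- The object of an LD category denoted by a formal expression. -/
def ev (L : LD C) {K : Type w} (e : K → C) : Tree K → C
  | .atom k => e k
  | .ot X Y => L.ot (ev L e X) (ev L e Y)
  | .pa X Y => L.pa (ev L e X) (ev L e Y)

theorem Tree.size_pos {K : Type w} {wt : K → ℕ} (hwt : ∀ k, 0 < wt k) (X : Tree K) :
    0 < X.size wt := by
  induction X with
  | atom k => exact hwt k
  | ot X Y hX hY => simp only [Tree.size]; omega
  | pa X Y hX hY => simp only [Tree.size]; omega

/-- `OtSplit L e X A B t` says that `t` splits the expression `X` at one of its `⊗`-nodes lying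
under `⊗`-nodes only. -/
inductive OtSplit_s2 (L : LD C) {K : Type w} (e : K → C) :
    ∀ X A B : Tree K, (ev L e X ⟶ L.ot (ev L e A) (ev L e B)) → Prop
  | base (A B : Tree K) : OtSplit_s2 L e (.ot A B) A B (𝟙 _)
  | left (Q : Tree K) {X A B : Tree K} {t : ev L e X ⟶ L.ot (ev L e A) (ev L e B)} :
      OtSplit_s2 L e X A B t →
      OtSplit_s2 L e (.ot Q X) (.ot Q A) B (L.otHom (𝟙 (ev L e Q)) t ≫ L.α _ _ _)
  | right (Q : Tree K) {X A B : Tree K} {t : ev L e X ⟶ L.ot (ev L e A) (ev L e B)} :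
      OtSplit_s2 L e X A B t →
      OtSplit_s2 L e (.ot X Q) A (.ot B Q) (L.otHom t (𝟙 (ev L e Q)) ≫ L.αInv _ _ _)

/-- A family of morphisms splitting atoms into `⅋`-products of two atoms. -/
abbrev AtomSplit (L : LD C) {K : Type w} (e : K → C) :=
  ∀ k a b : K, (e k ⟶ L.pa (e a) (e b)) → Prop

/-- `PaSplit L e S X A B t` says that `t` splits the expression `X` at one of its `⅋`-nodes, or at
one of its atoms according to `S`. -/
inductive PaSplit_s2 (L : LD C) {K : Type w} (e : K → C) (S : AtomSplit L e) :
    ∀ X A B : Tree K, (ev L e X ⟶ L.pa (ev L e A) (ev L e B)) → Prop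
  | atom {k a b : K} {t : e k ⟶ L.pa (e a) (e b)} :
      S k a b t → PaSplit_s2 L e S (.atom k) (.atom a) (.atom b) t
  | base (A B : Tree K) : PaSplit_s2 L e S (.pa A B) A B (𝟙 _)
  | left (Q : Tree K) {X A B : Tree K} {t : ev L e X ⟶ L.pa (ev L e A) (ev L e B)} :
      PaSplit_s2 L e S X A B t →
      PaSplit_s2 L e S (.pa Q X) (.pa Q A) B (L.paHom (𝟙 (ev L e Q)) t ≫ L.pα _ _ _)
  | right (Q : Tree K) {X A B : Tree K} {t : ev L e X ⟶ L.pa (ev L e A) (ev L e B)} :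
      PaSplit_s2 L e S X A B t →
      PaSplit_s2 L e S (.pa X Q) A (.pa B Q) (L.paHom t (𝟙 (ev L e Q)) ≫ L.pαInv _ _ _)
  | dl (Q : Tree K) {X A B : Tree K} {t : ev L e X ⟶ L.pa (ev L e A) (ev L e B)} :
      PaSplit_s2 L e S X A B t →
      PaSplit_s2 L e S (.ot Q X) (.ot Q A) B (L.otHom (𝟙 (ev L e Q)) t ≫ L.δl _ _ _)
  | dr (Q : Tree K) {X A B : Tree K} {t : ev L e X ⟶ L.pa (ev L e A) (ev L e B)} :
      PaSplit_s2 L e S X A B t →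
      PaSplit_s2 L e S (.ot X Q) A (.ot B Q) (L.otHom t (𝟙 (ev L e Q)) ≫ L.δr _ _ _)

section Split
variable {L : LD C} {K : Type w} {e : K → C} {S : AtomSplit L e}

theorem OtSplit_s2.size_eq (wt : K → ℕ) {X A B : Tree K} {t} (h : OtSplit_s2 L e X A B t) :
    X.size wt = A.size wt + B.size wt := by
  induction h <;> simp only [Tree.size] at * <;> omega

theorem PaSplit_s2.size_eq {wt : K → ℕ}
    (hS : ∀ (k a b : K) (t), S k a b t → wt k = wt a + wt b)
    {X A B : Tree K} {t} (h : PaSplit_s2 L e S X A B t) :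
    X.size wt = A.size wt + B.size wt := by
  induction h with
  | atom h => exact hS _ _ _ _ h
  | _ => simp only [Tree.size] at * <;> omega

/-- A `⊗`-splitting is determined by its source and the size of its left part. -/
theorem OtSplit_s2.unique {wt : K → ℕ} (hwt : ∀ k, 0 < wt k) {X A B : Tree K} {t}
    (h : OtSplit_s2 L e X A B t) {A' B' : Tree K} {t'} (h' : OtSplit_s2 L e X A' B' t')
    (hs : A.size wt = A'.size wt) :
    (⟨A, B, t⟩ : Σ A B : Tree K, (ev L e X ⟶ L.ot (ev L e A) (ev L e B))) = ⟨A', B', t'⟩ := by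
  have pos := Tree.size_pos hwt
  induction h generalizing A' B' with
  | base A B =>
    cases h' with
    | base => rfl
    | @left _ _ A' B' _ h' => simp only [Tree.size] at hs; grind
    | @right _ _ A' B' _ h' => grind [h'.size_eq wt]
  | @left Q X A B t h ih =>
    cases h' with
    | base => simp only [Tree.size] at hs; grind
    | left _ h' => cases ih h' (by simpa [Tree.size] using hs); rfl
    | @right _ _ A' B' _ h' => simp only [Tree.size] at hs; grind [h'.size_eq wt]
  | @right Q X A B t h ih =>
    cases h' with
    | base => grind [h.size_eq wt]
    | @left _ _ A' B' _ h' => simp only [Tree.size] at hs; grind [h.size_eq wt]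
    | right _ h' => cases ih h' hs; rfl

/-- A `⅋`-splitting is determined by its source and the size of its left part. -/
theorem PaSplit_s2.unique {wt : K → ℕ} (hwt : ∀ k, 0 < wt k)
    (hS : ∀ (k a b : K) (t), S k a b t → wt k = wt a + wt b)
    (hSu : ∀ (k a b a' b' : K) (t t'), S k a b t → S k a' b' t' → wt a = wt a' →
      (⟨a, b, t⟩ : Σ a b : K, (e k ⟶ L.pa (e a) (e b))) = ⟨a', b', t'⟩)
    {X A B : Tree K} {t} (h : PaSplit_s2 L e S X A B t)
    {A' B' : Tree K} {t'} (h' : PaSplit_s2 L e S X A' B' t') (hs : A.size wt = A'.size wt) :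
    (⟨A, B, t⟩ : Σ A B : Tree K, (ev L e X ⟶ L.pa (ev L e A) (ev L e B))) = ⟨A', B', t'⟩ := by
  have pos := Tree.size_pos hwt
  induction h generalizing A' B' with
  | atom h =>
    cases h' with
    | atom h' => cases hSu _ _ _ _ _ _ _ h h' hs; rfl
  | base A B =>
    cases h' with
    | base => rfl
    | @left _ _ A' B' _ h' => simp only [Tree.size] at hs; grind
    | @right _ _ A' B' _ h' => grind [h'.size_eq hS]
  | @left Q X A B t h ih =>
    cases h' with
    | base => simp only [Tree.size] at hs; grind
    | left _ h' => cases ih h' (by simpa [Tree.size] using hs); rfl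
    | @right _ _ A' B' _ h' => simp only [Tree.size] at hs; grind [h'.size_eq hS]
  | @right Q X A B t h ih =>
    cases h' with
    | base => grind [h.size_eq hS]
    | @left _ _ A' B' _ h' => simp only [Tree.size] at hs; grind [h.size_eq hS]
    | right _ h' => cases ih h' hs; rfl
  | @dl Q X A B t h ih =>
    cases h' with
    | dl _ h' => cases ih h' (by simpa [Tree.size] using hs); rfl
    | @dr _ _ A' B' _ h' => simp only [Tree.size] at hs; grind [h'.size_eq hS]
  | @dr Q X A B t h ih =>
    cases h' with
    | @dl _ _ A' B' _ h' => simp only [Tree.size] at hs; grind [h.size_eq hS]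
    | dr _ h' => cases ih h' hs; rfl

/-- Two successive `⊗`-splittings, the second one of the right factor, can be interchanged. -/
theorem OtSplit_s2.coassoc {X X₁ X₂ Y Z : Tree K} {s t} (hs : OtSplit_s2 L e X X₁ X₂ s)
    (ht : OtSplit_s2 L e X₂ Y Z t) :
    ∃ A t' p, OtSplit_s2 L e X A Z t' ∧ OtSplit_s2 L e A X₁ Y p ∧
      s ≫ L.otHom (𝟙 _) t ≫ L.α _ _ _ = t' ≫ L.otHom p (𝟙 _) := by
  induction hs generalizing Y Z with
  | base A B => exact ⟨_, _, _, .left _ ht, .base _ _, by simp [ev]⟩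
  | left Q hs ih =>
    obtain ⟨A, t', p, h₁, h₂, h⟩ := ih ht
    refine ⟨_, _, _, .left _ h₁, .left _ h₂, ?_⟩
    replace h := congrArg (L.otHom (𝟙 (ev L e Q))) h
    simp [ev, L.P1] at h ⊢
    simp [reassoc_of% h]
  | right Q hs ih =>
    cases ht with
    | base => exact ⟨_, _, _, .base _ _, hs, by simp [ev]⟩
    | left _ ht => exact ⟨_, _, _, .left _ ht, .right _ hs, by simp [ev, L.P1_inv_left]⟩
    | right _ ht =>
      obtain ⟨A, t', p, h₁, h₂, h⟩ := ih ht
      refine ⟨_, _, _, .right _ h₁, h₂, ?_⟩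
      replace h := congrArg (L.otHom · (𝟙 (ev L e Q))) h
      simp [ev, L.P1_inv_mid] at h ⊢
      simp [reassoc_of% h]

/-- Two successive `⊗`-splittings, the second one of the left factor, can be interchanged. -/
theorem OtSplit_s2.coassocInv {X X₁ X₂ Y Z : Tree K} {s t} (hs : OtSplit_s2 L e X X₁ X₂ s)
    (ht : OtSplit_s2 L e X₁ Y Z t) :
    ∃ A t' p, OtSplit_s2 L e X Y A t' ∧ OtSplit_s2 L e A Z X₂ p ∧
      s ≫ L.otHom t (𝟙 _) ≫ L.αInv _ _ _ = t' ≫ L.otHom (𝟙 _) p := by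
  induction hs generalizing Y Z with
  | base A B => exact ⟨_, _, _, .right _ ht, .base _ _, by simp [ev]⟩
  | right Q hs ih =>
    obtain ⟨A, t', p, h₁, h₂, h⟩ := ih ht
    refine ⟨_, _, _, .right _ h₁, .right _ h₂, ?_⟩
    replace h := congrArg (L.otHom · (𝟙 (ev L e Q))) h
    simp [ev, L.P1_inv] at h ⊢
    simp [reassoc_of% h]
  | left Q hs ih =>
    cases ht with
    | base => exact ⟨_, _, _, .base _ _, hs, by simp [ev]⟩
    | right _ ht => exact ⟨_, _, _, .right _ ht, .left _ hs, by simp [ev, L.P1_inv_right]⟩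
    | left _ ht =>
      obtain ⟨A, t', p, h₁, h₂, h⟩ := ih ht
      refine ⟨_, _, _, .left _ h₁, h₂, ?_⟩
      replace h := congrArg (L.otHom (𝟙 (ev L e Q))) h
      simp [ev, L.P1_inv_outer] at h ⊢
      simp [reassoc_of% h]

/-- A `⊗`-splitting followed by a `⅋`-splitting of the right factor. -/
theorem OtSplit_s2.codistribLeft {X X₁ X₂ Y Z : Tree K} {s t} (hs : OtSplit_s2 L e X X₁ X₂ s)
    (ht : PaSplit_s2 L e S X₂ Y Z t) :
    ∃ A t' p, PaSplit_s2 L e S X A Z t' ∧ OtSplit_s2 L e A X₁ Y p ∧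
      s ≫ L.otHom (𝟙 _) t ≫ L.δl _ _ _ = t' ≫ L.paHom p (𝟙 _) := by
  induction hs generalizing Y Z with
  | base A B => exact ⟨_, _, _, .dl _ ht, .base _ _, by simp [ev]⟩
  | left Q hs ih =>
    obtain ⟨A, t', p, h₁, h₂, h⟩ := ih ht
    refine ⟨_, _, _, .dl _ h₁, .left _ h₂, ?_⟩
    replace h := congrArg (L.otHom (𝟙 (ev L e Q))) h
    simp [ev, L.P2] at h ⊢
    simp [reassoc_of% h]
  | right Q hs ih =>
    cases ht with
    | dl _ ht => exact ⟨_, _, _, .dl _ ht, .right _ hs, by simp [ev, L.P2_inv]⟩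
    | dr _ ht =>
      obtain ⟨A, t', p, h₁, h₂, h⟩ := ih ht
      refine ⟨_, _, _, .dr _ h₁, h₂, ?_⟩
      replace h := congrArg (L.otHom · (𝟙 (ev L e Q))) h
      simp [ev, L.P3] at h ⊢
      simp [reassoc_of% h]

/-- A `⊗`-splitting followed by a `⅋`-splitting of the left factor. -/
theorem OtSplit_s2.codistribRight {X X₁ X₂ Y Z : Tree K} {s t} (hs : OtSplit_s2 L e X X₁ X₂ s)
    (ht : PaSplit_s2 L e S X₁ Y Z t) :
    ∃ A t' p, PaSplit_s2 L e S X Y A t' ∧ OtSplit_s2 L e A Z X₂ p ∧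
      s ≫ L.otHom t (𝟙 _) ≫ L.δr _ _ _ = t' ≫ L.paHom (𝟙 _) p := by
  induction hs generalizing Y Z with
  | base A B => exact ⟨_, _, _, .dr _ ht, .base _ _, by simp [ev]⟩
  | right Q hs ih =>
    obtain ⟨A, t', p, h₁, h₂, h⟩ := ih ht
    refine ⟨_, _, _, .dr _ h₁, .right _ h₂, ?_⟩
    replace h := congrArg (L.otHom · (𝟙 (ev L e Q))) h
    simp [ev, L.P5_inv] at h ⊢
    simp [reassoc_of% h]
  | left Q hs ih =>
    cases ht with
    | dr _ ht => exact ⟨_, _, _, .dr _ ht, .left _ hs, by simp [ev, ← L.P5]⟩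
    | dl _ ht =>
      obtain ⟨A, t', p, h₁, h₂, h⟩ := ih ht
      refine ⟨_, _, _, .dl _ h₁, h₂, ?_⟩
      replace h := congrArg (L.otHom (𝟙 (ev L e Q))) h
      simp [ev, ← L.P3] at h ⊢
      simp [reassoc_of% h]

/-- Coassociativity of `⅋`-splittings, the second one being of the right factor. -/
theorem PaSplit_s2.coassoc
    (hS : ∀ (k a b c d : K) (s t), S k a b s → S b c d t → ∃ l t' p, S k l d t' ∧ S l a c p ∧
      s ≫ L.paHom (𝟙 _) t ≫ L.pα _ _ _ = t' ≫ L.paHom p (𝟙 _))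
    {X X₁ X₂ Y Z : Tree K} {s t} (hs : PaSplit_s2 L e S X X₁ X₂ s)
    (ht : PaSplit_s2 L e S X₂ Y Z t) :
    ∃ A t' p, PaSplit_s2 L e S X A Z t' ∧ PaSplit_s2 L e S A X₁ Y p ∧
      s ≫ L.paHom (𝟙 _) t ≫ L.pα _ _ _ = t' ≫ L.paHom p (𝟙 _) := by
  induction hs generalizing Y Z with
  | atom hs =>
    cases ht with
    | atom ht =>
      obtain ⟨l, t', p, h₁, h₂, h⟩ := hS _ _ _ _ _ _ _ hs ht
      exact ⟨_, _, _, .atom h₁, .atom h₂, h⟩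
  | base A B => exact ⟨_, _, _, .left _ ht, .base _ _, by simp [ev]⟩
  | left Q hs ih =>
    obtain ⟨A, t', p, h₁, h₂, h⟩ := ih ht
    refine ⟨_, _, _, .left _ h₁, .left _ h₂, ?_⟩
    replace h := congrArg (L.paHom (𝟙 (ev L e Q))) h
    simp [ev, L.P8] at h ⊢
    simp [reassoc_of% h]
  | right Q hs ih =>
    cases ht with
    | base => exact ⟨_, _, _, .base _ _, hs, by simp [ev]⟩
    | left _ ht => exact ⟨_, _, _, .left _ ht, .right _ hs, by simp [ev, L.P8_inv_left]⟩
    | right _ ht =>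
      obtain ⟨A, t', p, h₁, h₂, h⟩ := ih ht
      refine ⟨_, _, _, .right _ h₁, h₂, ?_⟩
      replace h := congrArg (L.paHom · (𝟙 (ev L e Q))) h
      simp [ev, L.P8_inv_mid] at h ⊢
      simp [reassoc_of% h]
  | dl Q hs ih =>
    obtain ⟨A, t', p, h₁, h₂, h⟩ := ih ht
    refine ⟨_, _, _, .dl _ h₁, .dl _ h₂, ?_⟩
    replace h := congrArg (L.otHom (𝟙 (ev L e Q))) h
    simp [ev, L.P4] at h ⊢
    simp [reassoc_of% h]
  | dr Q hs ih =>
    cases ht with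
    | dl _ ht => exact ⟨_, _, _, .dl _ ht, .dr _ hs, by simp [ev, L.P6]⟩
    | dr _ ht =>
      obtain ⟨A, t', p, h₁, h₂, h⟩ := ih ht
      refine ⟨_, _, _, .dr _ h₁, h₂, ?_⟩
      replace h := congrArg (L.otHom · (𝟙 (ev L e Q))) h
      simp [ev, ← L.P7] at h ⊢
      simp [reassoc_of% h]

/-- Coassociativity of `⅋`-splittings, the second one being of the left factor. -/
theorem PaSplit_s2.coassocInv
    (hS : ∀ (k a b c d : K) (s t), S k a b s → S a c d t → ∃ r t' p, S k c r t' ∧ S r d b p ∧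
      s ≫ L.paHom t (𝟙 _) ≫ L.pαInv _ _ _ = t' ≫ L.paHom (𝟙 _) p)
    {X X₁ X₂ Y Z : Tree K} {s t} (hs : PaSplit_s2 L e S X X₁ X₂ s)
    (ht : PaSplit_s2 L e S X₁ Y Z t) :
    ∃ A t' p, PaSplit_s2 L e S X Y A t' ∧ PaSplit_s2 L e S A Z X₂ p ∧
      s ≫ L.paHom t (𝟙 _) ≫ L.pαInv _ _ _ = t' ≫ L.paHom (𝟙 _) p := by
  induction hs generalizing Y Z with
  | atom hs =>
    cases ht with
    | atom ht =>
      obtain ⟨l, t', p, h₁, h₂, h⟩ := hS _ _ _ _ _ _ _ hs ht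
      exact ⟨_, _, _, .atom h₁, .atom h₂, h⟩
  | base A B => exact ⟨_, _, _, .right _ ht, .base _ _, by simp [ev]⟩
  | right Q hs ih =>
    obtain ⟨A, t', p, h₁, h₂, h⟩ := ih ht
    refine ⟨_, _, _, .right _ h₁, .right _ h₂, ?_⟩
    replace h := congrArg (L.paHom · (𝟙 (ev L e Q))) h
    simp [ev, L.P8_inv] at h ⊢
    simp [reassoc_of% h]
  | left Q hs ih =>
    cases ht with
    | base => exact ⟨_, _, _, .base _ _, hs, by simp [ev]⟩
    | right _ ht => exact ⟨_, _, _, .right _ ht, .left _ hs, by simp [ev, L.P8_inv_right]⟩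
    | left _ ht =>
      obtain ⟨A, t', p, h₁, h₂, h⟩ := ih ht
      refine ⟨_, _, _, .left _ h₁, h₂, ?_⟩
      replace h := congrArg (L.paHom (𝟙 (ev L e Q))) h
      simp [ev, L.P8_inv_outer] at h ⊢
      simp [reassoc_of% h]
  | dr Q hs ih =>
    obtain ⟨A, t', p, h₁, h₂, h⟩ := ih ht
    refine ⟨_, _, _, .dr _ h₁, .dr _ h₂, ?_⟩
    replace h := congrArg (L.otHom · (𝟙 (ev L e Q))) h
    simp [ev, L.P7_inv] at h ⊢
    simp [reassoc_of% h]
  | dl Q hs ih =>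
    cases ht with
    | dr _ ht => exact ⟨_, _, _, .dr _ ht, .dl _ hs, by simp [ev, L.P6_inv]⟩
    | dl _ ht =>
      obtain ⟨A, t', p, h₁, h₂, h⟩ := ih ht
      refine ⟨_, _, _, .dl _ h₁, h₂, ?_⟩
      replace h := congrArg (L.otHom (𝟙 (ev L e Q))) h
      simp [ev, L.P4_inv] at h ⊢
      simp [reassoc_of% h]

end Split

section Norm
variable {L : LD C} {K : Type w} {e : K → C} {S : AtomSplit L e}

/-- A family of morphisms from expressions to atoms. -/
abbrev AtomFamily (L : LD C) {K : Type w} (e : K → C) :=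
  ∀ (X : Tree K) (k : K), (ev L e X ⟶ e k) → Prop

/-- Morphisms in normal form: the target is built up by splitting the source repeatedly, until
the remaining pieces are mapped to atoms by members of `M`. -/
inductive Norm (L : LD C) {K : Type w} (e : K → C) (S : AtomSplit L e) (M : AtomFamily L e) :
    ∀ X Y : Tree K, (ev L e X ⟶ ev L e Y) → Prop
  | atom {X : Tree K} {k : K} {f : ev L e X ⟶ e k} : M X k f → Norm L e S M X (.atom k) f
  | ot {X A B Y Z : Tree K} {t : ev L e X ⟶ L.ot (ev L e A) (ev L e B)}
      {f : ev L e A ⟶ ev L e Y} {g : ev L e B ⟶ ev L e Z} :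
      OtSplit_s2 L e X A B t → Norm L e S M A Y f → Norm L e S M B Z g →
      Norm L e S M X (.ot Y Z) (t ≫ L.otHom f g)
  | pa {X A B Y Z : Tree K} {t : ev L e X ⟶ L.pa (ev L e A) (ev L e B)}
      {f : ev L e A ⟶ ev L e Y} {g : ev L e B ⟶ ev L e Z} :
      PaSplit_s2 L e S X A B t → Norm L e S M A Y f → Norm L e S M B Z g →
      Norm L e S M X (.pa Y Z) (t ≫ L.paHom f g)

/-- The morphisms between expressions generated by `G` and the structure of an LD category. -/
inductive Gen (L : LD C) {K : Type w} (e : K → C)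
    (G : ∀ X Y : Tree K, (ev L e X ⟶ ev L e Y) → Prop) :
    ∀ X Y : Tree K, (ev L e X ⟶ ev L e Y) → Prop
  | of {X Y : Tree K} {f : ev L e X ⟶ ev L e Y} : G X Y f → Gen L e G X Y f
  | id (X : Tree K) : Gen L e G X X (𝟙 _)
  | comp {X Y Z : Tree K} {f : ev L e X ⟶ ev L e Y} {g : ev L e Y ⟶ ev L e Z} :
      Gen L e G X Y f → Gen L e G Y Z g → Gen L e G X Z (f ≫ g)
  | ot {X Y X' Y' : Tree K} {f : ev L e X ⟶ ev L e Y} {g : ev L e X' ⟶ ev L e Y'} :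
      Gen L e G X Y f → Gen L e G X' Y' g → Gen L e G (.ot X X') (.ot Y Y') (L.otHom f g)
  | pa {X Y X' Y' : Tree K} {f : ev L e X ⟶ ev L e Y} {g : ev L e X' ⟶ ev L e Y'} :
      Gen L e G X Y f → Gen L e G X' Y' g → Gen L e G (.pa X X') (.pa Y Y') (L.paHom f g)
  | α (A B D : Tree K) : Gen L e G (.ot A (.ot B D)) (.ot (.ot A B) D) (L.α _ _ _)
  | αInv (A B D : Tree K) : Gen L e G (.ot (.ot A B) D) (.ot A (.ot B D)) (L.αInv _ _ _)
  | pα (A B D : Tree K) : Gen L e G (.pa A (.pa B D)) (.pa (.pa A B) D) (L.pα _ _ _)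
  | pαInv (A B D : Tree K) : Gen L e G (.pa (.pa A B) D) (.pa A (.pa B D)) (L.pαInv _ _ _)
  | δl (A B D : Tree K) : Gen L e G (.ot A (.pa B D)) (.pa (.ot A B) D) (L.δl _ _ _)
  | δr (A B D : Tree K) : Gen L e G (.ot (.pa A B) D) (.pa A (.ot B D)) (L.δr _ _ _)

variable {M : AtomFamily L e} {G : ∀ X Y : Tree K, (ev L e X ⟶ ev L e Y) → Prop}

theorem Norm.size_eq {wt : K → ℕ} (hS : ∀ (k a b : K) (t), S k a b t → wt k = wt a + wt b)
    (hM : ∀ X k f, M X k f → X.size wt = wt k) {X Y : Tree K} {f} (h : Norm L e S M X Y f) :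
    X.size wt = Y.size wt := by
  induction h with
  | atom h => exact hM _ _ _ h
  | ot h _ _ ih₁ ih₂ => rw [h.size_eq wt, ih₁, ih₂, Tree.size]
  | pa h _ _ ih₁ ih₂ => rw [h.size_eq hS, ih₁, ih₂, Tree.size]

/-- There is at most one morphism in normal form between two expressions. -/
theorem Norm.unique {wt : K → ℕ} (hwt : ∀ k, 0 < wt k)
    (hS : ∀ (k a b : K) (t), S k a b t → wt k = wt a + wt b)
    (hSu : ∀ (k a b a' b' : K) (t t'), S k a b t → S k a' b' t' → wt a = wt a' →
      (⟨a, b, t⟩ : Σ a b : K, (e k ⟶ L.pa (e a) (e b))) = ⟨a', b', t'⟩)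
    (hM : ∀ X k f, M X k f → X.size wt = wt k)
    (hMu : ∀ X k f f', M X k f → M X k f' → f = f')
    {X Y : Tree K} {f} (h : Norm L e S M X Y f) {f'} (h' : Norm L e S M X Y f') : f = f' := by
  induction h with
  | atom h =>
    cases h' with
    | atom h' => exact hMu _ _ _ _ h h'
  | ot h hf hg ihf ihg =>
    cases h' with
    | ot h' hf' hg' =>
      cases h.unique hwt h' ((hf.size_eq hS hM).trans (hf'.size_eq hS hM).symm)
      rw [ihf hf', ihg hg']
  | pa h hf hg ihf ihg =>
    cases h' with
    | pa h' hf' hg' =>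
      cases h.unique hwt hS hSu h' ((hf.size_eq hS hM).trans (hf'.size_eq hS hM).symm)
      rw [ihf hf', ihg hg']

theorem LD.otHom_comp_right (L : LD C) {A B X Y Z : C} (f : A ⟶ B) (t : X ⟶ Y) (g : Y ⟶ Z) :
    L.otHom f (t ≫ g) = L.otHom (𝟙 A) t ≫ L.otHom f g := by
  rw [← L.otHom_comp, Category.id_comp]

theorem LD.otHom_comp_left (L : LD C) {A B X Y Z : C} (f : A ⟶ B) (t : X ⟶ Y) (g : Y ⟶ Z) :
    L.otHom (t ≫ g) f = L.otHom t (𝟙 A) ≫ L.otHom g f := by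
  rw [← L.otHom_comp, Category.id_comp]

theorem LD.paHom_comp_right (L : LD C) {A B X Y Z : C} (f : A ⟶ B) (t : X ⟶ Y) (g : Y ⟶ Z) :
    L.paHom f (t ≫ g) = L.paHom (𝟙 A) t ≫ L.paHom f g := by
  rw [← L.paHom_comp, Category.id_comp]

theorem LD.paHom_comp_left (L : LD C) {A B X Y Z : C} (f : A ⟶ B) (t : X ⟶ Y) (g : Y ⟶ Z) :
    L.paHom (t ≫ g) f = L.paHom t (𝟙 A) ≫ L.paHom g f := by
  rw [← L.paHom_comp, Category.id_comp]

/-- Normal forms are closed under composition with generated morphisms. -/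
theorem Norm.comp_gen
    (hS : ∀ (k a b c d : K) (s t), S k a b s → S b c d t → ∃ l t' p, S k l d t' ∧ S l a c p ∧
      s ≫ L.paHom (𝟙 _) t ≫ L.pα _ _ _ = t' ≫ L.paHom p (𝟙 _))
    (hS' : ∀ (k a b c d : K) (s t), S k a b s → S a c d t → ∃ r t' p, S k c r t' ∧ S r d b p ∧
      s ≫ L.paHom t (𝟙 _) ≫ L.pαInv _ _ _ = t' ≫ L.paHom (𝟙 _) p)
    (hG : ∀ X Y f, G X Y f → ∀ Z p, Norm L e S M Z X p → Norm L e S M Z Y (p ≫ f))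
    {X Y Z : Tree K} {p f} (hp : Norm L e S M Z X p) (hf : Gen L e G X Y f) :
    Norm L e S M Z Y (p ≫ f) := by
  induction hf generalizing Z with
  | of h => exact hG _ _ _ h _ _ hp
  | id X => rwa [Category.comp_id]
  | comp hf hg ihf ihg => rw [← Category.assoc]; exact ihg (ihf hp)
  | ot hf hg ihf ihg =>
    cases hp with
    | ot h h₁ h₂ =>
      convert Norm.ot h (ihf h₁) (ihg h₂) using 1
      simp only [ev, Category.assoc, L.otHom_comp]
  | pa hf hg ihf ihg =>
    cases hp with
    | pa h h₁ h₂ =>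
      convert Norm.pa h (ihf h₁) (ihg h₂) using 1
      simp only [ev, Category.assoc, L.paHom_comp]
  | α =>
    obtain _ | ⟨hs, h₁, _ | ⟨ht, h₂, h₃⟩⟩ := hp
    obtain ⟨A, t', p, hs', ht', h⟩ := hs.coassoc ht
    convert Norm.ot hs' (.ot ht' h₁ h₂) h₃ using 1
    simp only [ev, Category.assoc]
    rw [L.otHom_comp_right, L.otHom_comp_left, ← reassoc_of% h, ← L.α_natural, Category.assoc]
  | αInv =>
    obtain _ | ⟨hs, _ | ⟨ht, h₁, h₂⟩, h₃⟩ := hp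
    obtain ⟨A, t', p, hs', ht', h⟩ := hs.coassocInv ht
    convert Norm.ot hs' h₁ (.ot ht' h₂ h₃) using 1
    simp only [ev, Category.assoc]
    rw [L.otHom_comp_right, L.otHom_comp_left, ← reassoc_of% h, ← L.αInv_natural, Category.assoc]
  | pα =>
    obtain _ | _ | ⟨hs, h₁, _ | _ | ⟨ht, h₂, h₃⟩⟩ := hp
    obtain ⟨A, t', p, hs', ht', h⟩ := hs.coassoc hS ht
    convert Norm.pa hs' (.pa ht' h₁ h₂) h₃ using 1
    simp only [ev, Category.assoc]
    rw [L.paHom_comp_right, L.paHom_comp_left, ← reassoc_of% h, ← L.pα_natural, Category.assoc]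
  | pαInv =>
    obtain _ | _ | ⟨hs, _ | _ | ⟨ht, h₁, h₂⟩, h₃⟩ := hp
    obtain ⟨A, t', p, hs', ht', h⟩ := hs.coassocInv hS' ht
    convert Norm.pa hs' h₁ (.pa ht' h₂ h₃) using 1
    simp only [ev, Category.assoc]
    rw [L.paHom_comp_right, L.paHom_comp_left, ← reassoc_of% h, ← L.pαInv_natural, Category.assoc]
  | δl =>
    obtain _ | ⟨hs, h₁, _ | _ | ⟨ht, h₂, h₃⟩⟩ := hp
    obtain ⟨A, t', p, hs', ht', h⟩ := hs.codistribLeft ht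
    convert Norm.pa hs' (.ot ht' h₁ h₂) h₃ using 1
    simp only [ev, Category.assoc]
    rw [L.otHom_comp_right, L.paHom_comp_left, ← reassoc_of% h, ← L.δl_natural, Category.assoc]
  | δr =>
    obtain _ | ⟨hs, _ | _ | ⟨ht, h₁, h₂⟩, h₃⟩ := hp
    obtain ⟨A, t', p, hs', ht', h⟩ := hs.codistribRight ht
    convert Norm.pa hs' h₁ (.ot ht' h₂ h₃) using 1
    simp only [ev, Category.assoc]
    rw [L.otHom_comp_left, L.paHom_comp_right, ← reassoc_of% h, ← L.δr_natural, Category.assoc]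

theorem Norm.id (hM : ∀ k, M (.atom k) k (𝟙 _)) (X : Tree K) : Norm L e S M X X (𝟙 _) := by
  induction X with
  | atom k => exact .atom (hM k)
  | ot X Y hX hY => convert Norm.ot (.base X Y) hX hY using 1; simp [ev]
  | pa X Y hX hY => convert Norm.pa (.base X Y) hX hY using 1; simp [ev]

end Norm

section Source
variable {L : LD C} {K : Type w} {e : K → C}

/-- The identities of atoms. -/
inductive IdAtom (L : LD C) {K : Type w} (e : K → C) :
    ∀ (X : Tree K) (k : K), (ev L e X ⟶ e k) → Prop
  | mk (k : K) : IdAtom L e (.atom k) k (𝟙 _)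

/-- The morphisms between expressions generated by the structure of an LD category alone. -/
abbrev FreeGen (L : LD C) {K : Type w} (e : K → C) := Gen L e fun _ _ _ => False

/-- The `⅋`-splittings that do not split atoms. -/
abbrev FreePaSplit (L : LD C) {K : Type w} (e : K → C) := PaSplit_s2 L e fun _ _ _ _ => False

/-- The normal forms of the morphisms in `FreeGen`. -/
abbrev FreeNorm (L : LD C) {K : Type w} (e : K → C) :=
  Norm L e (fun _ _ _ _ => False) (IdAtom L e)

theorem FreeNorm.comp_gen {X Y Z : Tree K} {p f} (hp : FreeNorm L e Z X p)
    (hf : FreeGen L e X Y f) : FreeNorm L e Z Y (p ≫ f) :=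
  Norm.comp_gen (fun _ _ _ _ _ _ _ h => h.elim) (fun _ _ _ _ _ _ _ h => h.elim)
    (fun _ _ _ h => h.elim) hp hf

theorem FreeNorm.size_eq {X Y : Tree K} {f} (h : FreeNorm L e X Y f) :
    X.size (fun _ => 1) = Y.size fun _ => 1 :=
  Norm.size_eq (wt := fun _ => 1) (fun _ _ _ _ h => h.elim) (by rintro _ _ _ ⟨⟩; rfl) h

theorem FreeNorm.unique {X Y : Tree K} {f g} (hf : FreeNorm L e X Y f)
    (hg : FreeNorm L e X Y g) : f = g :=
  Norm.unique (wt := fun _ => 1) (fun _ => one_pos) (fun _ _ _ _ h => h.elim)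
    (fun _ _ _ _ _ _ _ h => h.elim) (by rintro _ _ _ ⟨⟩; rfl)
    (by rintro _ _ _ _ ⟨⟩ ⟨⟩; rfl) hf hg

end Source

section Target
variable (F : FrobLDFunctor Cc Dd LC LDd) {K : Type w} (e : K → Cc)

/-- The images under `F` of the expressions in the source category, the atoms of the expressions
in the target category. -/
abbrev FrobLDFunctor.atoms (A : Tree K) : Dd := F.toFunctor.obj (ev LC e A)

/-- The splittings of the image under `F` of an expression induced by its `⅋`-splittings. -/
def FrobLDFunctor.atomSplit : AtomSplit LDd (F.atoms e) := fun A A₁ A₂ f =>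
  ∃ t, FreePaSplit LC e A A₁ A₂ t ∧ f = F.toFunctor.map t ≫ F.Δ _ _

/-- The iterated multiplications of `F`. -/
inductive Merge : ∀ (X : Tree (Tree K)) (A : Tree K),
    (ev LDd (F.atoms e) X ⟶ F.atoms e A) → Prop
  | atom (A : Tree K) : Merge (.atom A) A (𝟙 _)
  | ot {X Y : Tree (Tree K)} {A B : Tree K} {f : ev LDd (F.atoms e) X ⟶ F.atoms e A}
      {g : ev LDd (F.atoms e) Y ⟶ F.atoms e B} :
      Merge X A f → Merge Y B g → Merge (.ot X Y) (.ot A B) (LDd.otHom f g ≫ F.μ _ _)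

/-- The normal forms of morphisms whose target is the image under `F` of an expression. -/
def FrobLDFunctor.atomFamily : AtomFamily LDd (F.atoms e) := fun X A f =>
  ∃ A₀ m h, Merge F e X A₀ m ∧ FreeNorm LC e A₀ A h ∧ f = m ≫ F.toFunctor.map h

/-- The generators of the target category coming from the Frobenius structure. -/
inductive FrobLDFunctor.Generator : ∀ X Y : Tree (Tree K),
    (ev LDd (F.atoms e) X ⟶ ev LDd (F.atoms e) Y) → Prop
  | μ (A B : Tree K) : Generator (.ot (.atom A) (.atom B)) (.atom (.ot A B)) (F.μ _ _)
  | Δ (A B : Tree K) : Generator (.atom (.pa A B)) (.pa (.atom A) (.atom B)) (F.Δ _ _)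
  | map {A B : Tree K} {h : ev LC e A ⟶ ev LC e B} :
      FreeGen LC e A B h → Generator (.atom A) (.atom B) (F.toFunctor.map h)

/-- The normal forms of the morphisms in the target category. -/
abbrev FrobLDFunctor.TargetNorm := Norm LDd (F.atoms e) (F.atomSplit e) (F.atomFamily e)

variable {F e}

theorem FrobLDFunctor.H1_inv (F : FrobLDFunctor Cc Dd LC LDd) (A B E : Cc) :
    LDd.αInv _ _ _ ≫ LDd.otHom (𝟙 (F.toFunctor.obj A)) (F.μ B E) ≫ F.μ A (LC.ot B E) =
      LDd.otHom (F.μ A B) (𝟙 _) ≫ F.μ _ _ ≫ F.toFunctor.map (LC.αInv A B E) := by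
  have h := congrArg (fun k => LDd.αInv _ _ _ ≫ k ≫ F.toFunctor.map (LC.αInv A B E)) (F.H1 A B E)
  simpa [← F.toFunctor.map_comp, LC.α_αInv, reassoc_of% LDd.αInv_α] using h.symm

theorem FrobLDFunctor.H4_inv (F : FrobLDFunctor Cc Dd LC LDd) (A B E : Cc) :
    F.Δ (LC.pa A B) E ≫ LDd.paHom (F.Δ A B) (𝟙 (F.toFunctor.obj E)) ≫ LDd.pαInv _ _ _ =
      F.toFunctor.map (LC.pαInv A B E) ≫ F.Δ _ _ ≫ LDd.paHom (𝟙 _) (F.Δ B E) := by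
  have h := congrArg (fun k => F.toFunctor.map (LC.pαInv A B E) ≫ k ≫ LDd.pαInv _ _ _) (F.H4 A B E)
  simpa [← F.toFunctor.map_comp_assoc, LC.pαInv_pα, LDd.pα_pαInv] using h.symm

theorem FrobLDFunctor.atomSplit_coassoc (k a b c d : Tree K) (s t) (hs : F.atomSplit e k a b s)
    (ht : F.atomSplit e b c d t) :
    ∃ l t' p, F.atomSplit e k l d t' ∧ F.atomSplit e l a c p ∧
      s ≫ LDd.paHom (𝟙 _) t ≫ LDd.pα _ _ _ = t' ≫ LDd.paHom p (𝟙 _) := by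
  obtain ⟨s, hs, rfl⟩ := hs
  obtain ⟨t, ht, rfl⟩ := ht
  obtain ⟨A, t', p, hs', ht', h⟩ := hs.coassoc (fun _ _ _ _ _ _ _ h => h.elim) ht
  refine ⟨A, _, _, ⟨_, hs', rfl⟩, ⟨_, ht', rfl⟩, ?_⟩
  have h₁ := F.Δ_natural (𝟙 (ev LC e a)) t
  have h₂ := F.Δ_natural p (𝟙 (ev LC e d))
  rw [F.toFunctor.map_id] at h₁ h₂
  rw [LDd.id_paHom_comp, LDd.paHom_comp_id_s2, Category.assoc, Category.assoc, Category.assoc,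
    ← reassoc_of% h₁, F.H4, ← F.toFunctor.map_comp_assoc, ← F.toFunctor.map_comp_assoc,
    Category.assoc, h, F.toFunctor.map_comp_assoc, reassoc_of% h₂]

theorem FrobLDFunctor.atomSplit_coassocInv (k a b c d : Tree K) (s t)
    (hs : F.atomSplit e k a b s) (ht : F.atomSplit e a c d t) :
    ∃ r t' p, F.atomSplit e k c r t' ∧ F.atomSplit e r d b p ∧
      s ≫ LDd.paHom t (𝟙 _) ≫ LDd.pαInv _ _ _ = t' ≫ LDd.paHom (𝟙 _) p := by
  obtain ⟨s, hs, rfl⟩ := hs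
  obtain ⟨t, ht, rfl⟩ := ht
  obtain ⟨A, t', p, hs', ht', h⟩ := hs.coassocInv (fun _ _ _ _ _ _ _ h => h.elim) ht
  refine ⟨A, _, _, ⟨_, hs', rfl⟩, ⟨_, ht', rfl⟩, ?_⟩
  have h₁ := F.Δ_natural t (𝟙 (ev LC e b))
  have h₂ := F.Δ_natural (𝟙 (ev LC e c)) p
  rw [F.toFunctor.map_id] at h₁ h₂
  rw [LDd.id_paHom_comp, LDd.paHom_comp_id_s2, Category.assoc, Category.assoc, Category.assoc,
    ← reassoc_of% h₁, F.H4_inv, ← F.toFunctor.map_comp_assoc, ← F.toFunctor.map_comp_assoc,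
    Category.assoc, h, F.toFunctor.map_comp_assoc, reassoc_of% h₂]

theorem Merge.size_eq {X : Tree (Tree K)} {A : Tree K} {m} (h : Merge F e X A m) :
    X.size (fun B => B.size fun _ => 1) = A.size fun _ => 1 := by
  induction h with
  | atom A => rfl
  | ot _ _ ih₁ ih₂ => simp only [Tree.size, ih₁, ih₂]

theorem Merge.unique {X : Tree (Tree K)} {A A' : Tree K} {m m'} (h : Merge F e X A m)
    (h' : Merge F e X A' m') :
    (⟨A, m⟩ : Σ A : Tree K, (ev LDd (F.atoms e) X ⟶ F.atoms e A)) = ⟨A', m'⟩ := by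
  induction h generalizing A' with
  | atom A => cases h'; rfl
  | ot _ _ ih₁ ih₂ =>
    cases h' with
    | ot h₁ h₂ => cases ih₁ h₁; cases ih₂ h₂; rfl

theorem FrobLDFunctor.TargetNorm.unique {X Y : Tree (Tree K)} {f g}
    (hf : F.TargetNorm e X Y f) (hg : F.TargetNorm e X Y g) : f = g := by
  refine Norm.unique (wt := fun B => B.size fun _ => 1) (Tree.size_pos fun _ => one_pos)
    ?_ ?_ ?_ ?_ hf hg
  · rintro _ _ _ _ ⟨t, h, -⟩
    exact h.size_eq fun _ _ _ _ h => h.elim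
  · rintro _ _ _ _ _ _ _ ⟨t, h, rfl⟩ ⟨t', h', rfl⟩ hs
    cases h.unique (wt := fun _ => 1) (fun _ => one_pos) (fun _ _ _ _ h => h.elim)
      (fun _ _ _ _ _ _ _ h => h.elim) h' hs
    rfl
  · rintro _ _ _ ⟨A, m, h, hm, hh, -⟩
    exact hm.size_eq.trans hh.size_eq
  · rintro _ _ _ _ ⟨A, m, h, hm, hh, rfl⟩ ⟨A', m', h', hm', hh', rfl⟩
    cases hm.unique hm'
    rw [hh.unique hh']

theorem FrobLDFunctor.μ_id_left (F : FrobLDFunctor Cc Dd LC LDd) (A : Cc) {B E : Cc} (f : B ⟶ E) :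
    LDd.otHom (𝟙 (F.toFunctor.obj A)) (F.toFunctor.map f) ≫ F.μ A E =
      F.μ A B ≫ F.toFunctor.map (LC.otHom (𝟙 A) f) := by
  rw [← F.toFunctor.map_id, F.μ_natural]

theorem FrobLDFunctor.μ_id_right (F : FrobLDFunctor Cc Dd LC LDd) (A : Cc) {B E : Cc} (f : B ⟶ E) :
    LDd.otHom (F.toFunctor.map f) (𝟙 (F.toFunctor.obj A)) ≫ F.μ E A =
      F.μ B A ≫ F.toFunctor.map (LC.otHom f (𝟙 A)) := by
  rw [← F.toFunctor.map_id, F.μ_natural]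

theorem FrobLDFunctor.merge_μ (F : FrobLDFunctor Cc Dd LC LDd) {X X₁ X₂ : Dd} {A B A' B' D : Cc}
    {s : X ⟶ LDd.ot X₁ X₂} {g : X₁ ⟶ F.toFunctor.obj A} {h : X₂ ⟶ F.toFunctor.obj B}
    {m : X ⟶ F.toFunctor.obj D} {k : D ⟶ LC.ot A B} (p : A ⟶ A') (q : B ⟶ B')
    (w : s ≫ LDd.otHom g h ≫ F.μ A B = m ≫ F.toFunctor.map k) :
    (s ≫ LDd.otHom (g ≫ F.toFunctor.map p) (h ≫ F.toFunctor.map q)) ≫ F.μ A' B' =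
      m ≫ F.toFunctor.map (k ≫ LC.otHom p q) := by
  rw [LDd.otHom_comp, Category.assoc, Category.assoc, F.μ_natural, reassoc_of% w,
    F.toFunctor.map_comp]

theorem FrobLDFunctor.merge_Δ (F : FrobLDFunctor Cc Dd LC LDd) {X X₁ X₂ : Dd} {A B A' B' D : Cc}
    {s : X ⟶ LDd.pa X₁ X₂} {g : X₁ ⟶ F.toFunctor.obj A} {h : X₂ ⟶ F.toFunctor.obj B}
    {m : X ⟶ F.toFunctor.obj D} {k : D ⟶ LC.pa A B} (p : A ⟶ A') (q : B ⟶ B')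
    (w : m ≫ F.toFunctor.map k ≫ F.Δ A B = s ≫ LDd.paHom g h) :
    (m ≫ F.toFunctor.map (k ≫ LC.paHom p q)) ≫ F.Δ A' B' =
      s ≫ LDd.paHom (g ≫ F.toFunctor.map p) (h ≫ F.toFunctor.map q) := by
  rw [LDd.paHom_comp, F.toFunctor.map_comp, Category.assoc, Category.assoc, F.Δ_natural,
    reassoc_of% w]

theorem FrobLDFunctor.merge_α (F : FrobLDFunctor Cc Dd LC LDd) {Q X X₁ X₂ : Dd} {A B E D : Cc}
    (f : Q ⟶ F.toFunctor.obj A) {s : X ⟶ LDd.ot X₁ X₂} {g : X₁ ⟶ F.toFunctor.obj B}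
    {h : X₂ ⟶ F.toFunctor.obj E} {m : X ⟶ F.toFunctor.obj D} {k : D ⟶ LC.ot B E}
    (w : s ≫ LDd.otHom g h ≫ F.μ B E = m ≫ F.toFunctor.map k) :
    (LDd.otHom (𝟙 Q) s ≫ LDd.α _ _ _) ≫ LDd.otHom (LDd.otHom f g ≫ F.μ A B) h ≫ F.μ _ _ =
      (LDd.otHom f m ≫ F.μ A D) ≫ F.toFunctor.map (LC.otHom (𝟙 A) k ≫ LC.α A B E) := by
  have w' := congrArg (fun x => LDd.otHom f x ≫ F.μ _ _ ≫ F.toFunctor.map (LC.α A B E)) w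
  rw [← Category.comp_id h, LDd.otHom_comp, Category.assoc, Category.assoc,
    ← reassoc_of% (LDd.α_natural f g h), F.H1, F.toFunctor.map_comp, Category.assoc,
    ← reassoc_of% (F.μ_id_left A k)]
  simpa only [← LDd.otHom_comp, ← reassoc_of% LDd.otHom_comp, Category.id_comp, Category.comp_id,
    Category.assoc] using w'

theorem FrobLDFunctor.merge_αInv (F : FrobLDFunctor Cc Dd LC LDd) {Q X X₁ X₂ : Dd} {A B E D : Cc}
    (f : Q ⟶ F.toFunctor.obj E) {s : X ⟶ LDd.ot X₁ X₂} {g : X₁ ⟶ F.toFunctor.obj A}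
    {h : X₂ ⟶ F.toFunctor.obj B} {m : X ⟶ F.toFunctor.obj D} {k : D ⟶ LC.ot A B}
    (w : s ≫ LDd.otHom g h ≫ F.μ A B = m ≫ F.toFunctor.map k) :
    (LDd.otHom s (𝟙 Q) ≫ LDd.αInv _ _ _) ≫ LDd.otHom g (LDd.otHom h f ≫ F.μ B E) ≫ F.μ _ _ =
      (LDd.otHom m f ≫ F.μ D E) ≫ F.toFunctor.map (LC.otHom k (𝟙 E) ≫ LC.αInv A B E) := by
  have w' := congrArg (fun x => LDd.otHom x f ≫ F.μ _ _ ≫ F.toFunctor.map (LC.αInv A B E)) w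
  rw [← Category.comp_id g, LDd.otHom_comp, Category.assoc, Category.assoc,
    ← reassoc_of% (LDd.αInv_natural g h f), F.H1_inv, F.toFunctor.map_comp, Category.assoc,
    ← reassoc_of% (F.μ_id_right E k)]
  simpa only [← LDd.otHom_comp, ← reassoc_of% LDd.otHom_comp, Category.id_comp, Category.comp_id,
    Category.assoc] using w'

theorem FrobLDFunctor.merge_δl (F : FrobLDFunctor Cc Dd LC LDd) {Q X X₁ X₂ : Dd} {A B E D : Cc}
    (f : Q ⟶ F.toFunctor.obj A) {s : X ⟶ LDd.pa X₁ X₂} {g : X₁ ⟶ F.toFunctor.obj B}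
    {h : X₂ ⟶ F.toFunctor.obj E} {m : X ⟶ F.toFunctor.obj D} {k : D ⟶ LC.pa B E}
    (w : m ≫ F.toFunctor.map k ≫ F.Δ B E = s ≫ LDd.paHom g h) :
    (LDd.otHom f m ≫ F.μ A D) ≫ F.toFunctor.map (LC.otHom (𝟙 A) k ≫ LC.δl A B E) ≫ F.Δ _ _ =
      (LDd.otHom (𝟙 Q) s ≫ LDd.δl _ _ _) ≫ LDd.paHom (LDd.otHom f g ≫ F.μ A B) h := by
  have w' := congrArg (fun x => LDd.otHom f x ≫ LDd.δl _ _ _ ≫ LDd.paHom (F.μ A B) (𝟙 _)) w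
  rw [← Category.comp_id h, LDd.paHom_comp, Category.assoc, Category.assoc,
    ← reassoc_of% (LDd.δl_natural f g h), F.toFunctor.map_comp, Category.assoc,
    ← reassoc_of% (F.μ_id_left A k), ← F.H2]
  simpa only [← LDd.otHom_comp, ← reassoc_of% LDd.otHom_comp, Category.id_comp, Category.comp_id,
    Category.assoc] using w'

theorem FrobLDFunctor.merge_δr (F : FrobLDFunctor Cc Dd LC LDd) {Q X X₁ X₂ : Dd} {A B E D : Cc}
    (f : Q ⟶ F.toFunctor.obj E) {s : X ⟶ LDd.pa X₁ X₂} {g : X₁ ⟶ F.toFunctor.obj A}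
    {h : X₂ ⟶ F.toFunctor.obj B} {m : X ⟶ F.toFunctor.obj D} {k : D ⟶ LC.pa A B}
    (w : m ≫ F.toFunctor.map k ≫ F.Δ A B = s ≫ LDd.paHom g h) :
    (LDd.otHom m f ≫ F.μ D E) ≫ F.toFunctor.map (LC.otHom k (𝟙 E) ≫ LC.δr A B E) ≫ F.Δ _ _ =
      (LDd.otHom s (𝟙 Q) ≫ LDd.δr _ _ _) ≫ LDd.paHom g (LDd.otHom h f ≫ F.μ B E) := by
  have hw := congrArg (fun x => LDd.otHom x f ≫ LDd.δr _ _ _ ≫ LDd.paHom (𝟙 _) (F.μ B E)) w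
  rw [← Category.comp_id g, LDd.paHom_comp, Category.assoc, Category.assoc,
    ← reassoc_of% (LDd.δr_natural g h f), F.toFunctor.map_comp, Category.assoc,
    ← reassoc_of% (F.μ_id_right E k), ← F.H3]
  simpa only [← LDd.otHom_comp, ← reassoc_of% LDd.otHom_comp, Category.id_comp, Category.comp_id,
    Category.assoc] using hw

/-- Iterated multiplications turn a `⊗`-splitting in the target category into one in the source
category. -/
theorem OtSplit_s2.merge {X X₁ X₂ : Tree (Tree K)} {s} (hs : OtSplit_s2 LDd (F.atoms e) X X₁ X₂ s)
    {A₁ A₂ : Tree K} {m₁ m₂} (h₁ : Merge F e X₁ A₁ m₁) (h₂ : Merge F e X₂ A₂ m₂) :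
    ∃ A m k, Merge F e X A m ∧ OtSplit_s2 LC e A A₁ A₂ k ∧
      s ≫ LDd.otHom m₁ m₂ ≫ F.μ _ _ = m ≫ F.toFunctor.map k := by
  induction hs generalizing A₁ A₂ with
  | base =>
    refine ⟨_, _, _, .ot h₁ h₂, .base _ _, ?_⟩
    have h := Category.comp_id (LDd.otHom m₁ m₂ ≫ F.μ _ _)
    rw [← F.toFunctor.map_id] at h
    exact (Category.id_comp _).trans h.symm
  | left Q hs ih =>
    cases h₁ with
    | @ot _ _ A B f g hQ h₁ =>
      obtain ⟨D, m, k, hm, hk, h⟩ := ih h₁ h₂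
      exact ⟨_, _, _, .ot hQ hm, .left _ hk, F.merge_α f h⟩
  | right Q hs ih =>
    cases h₂ with
    | @ot _ _ A B f g h₂ hQ =>
      obtain ⟨D, m, k, hm, hk, h⟩ := ih h₁ h₂
      exact ⟨_, _, _, .ot hm hQ, .right _ hk, F.merge_αInv g h⟩

/-- Iterated multiplications turn a `⅋`-splitting in the source category into one in the target
category. -/
theorem Merge.paSplit {X : Tree (Tree K)} {A A₁ A₂ : Tree K} {m t} (hm : Merge F e X A m)
    (ht : FreePaSplit LC e A A₁ A₂ t) :
    ∃ X₁ X₂ t' m₁ m₂, PaSplit_s2 LDd (F.atoms e) (F.atomSplit e) X X₁ X₂ t' ∧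
      Merge F e X₁ A₁ m₁ ∧ Merge F e X₂ A₂ m₂ ∧
      m ≫ F.toFunctor.map t ≫ F.Δ _ _ = t' ≫ LDd.paHom m₁ m₂ := by
  induction hm generalizing A₁ A₂ with
  | atom A => exact ⟨_, _, _, _, _, .atom ⟨t, ht, rfl⟩, .atom _, .atom _, by simp [ev]⟩
  | @ot X Y A B f g hf hg ihf ihg =>
    cases ht with
    | dl _ ht =>
      obtain ⟨X₁, X₂, t', m₁, m₂, hs, h₁, h₂, h⟩ := ihg ht
      exact ⟨_, _, _, _, _, .dl _ hs, .ot hf h₁, h₂, F.merge_δl f h⟩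
    | dr _ ht =>
      obtain ⟨X₁, X₂, t', m₁, m₂, hs, h₁, h₂, h⟩ := ihf ht
      exact ⟨_, _, _, _, _, .dr _ hs, h₁, .ot h₂ hg, F.merge_δr g h⟩

theorem FrobLDFunctor.TargetNorm.comp_generator {X Y Z : Tree (Tree K)} {p f}
    (hp : F.TargetNorm e Z X p) (hf : F.Generator e X Y f) : F.TargetNorm e Z Y (p ≫ f) := by
  cases hf with
  | μ A B =>
    obtain _ | ⟨hs, ⟨A₁, m₁, k₁, hm₁, hk₁, rfl⟩, ⟨A₂, m₂, k₂, hm₂, hk₂, rfl⟩⟩ := hp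
    obtain ⟨A₀, m, k, hm, hk, h⟩ := hs.merge hm₁ hm₂
    refine .atom ⟨A₀, m, _, hm, .ot hk hk₁ hk₂, ?_⟩
    exact F.merge_μ k₁ k₂ h
  | Δ A B =>
    obtain ⟨A₀, m, _, hm, _ | _ | ⟨ht, h₁, h₂⟩, rfl⟩ := hp
    obtain ⟨X₁, X₂, t', m₁, m₂, hs, hm₁, hm₂, h⟩ := hm.paSplit ht
    have h₁' : F.TargetNorm e X₁ (.atom A) _ := .atom ⟨_, _, _, hm₁, h₁, rfl⟩
    have h₂' : F.TargetNorm e X₂ (.atom B) _ := .atom ⟨_, _, _, hm₂, h₂, rfl⟩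
    convert Norm.pa hs h₁' h₂' using 1
    exact F.merge_Δ _ _ h
  | map hh =>
    obtain ⟨A₀, m, k, hm, hk, rfl⟩ := hp
    exact .atom ⟨A₀, m, _, hm, hk.comp_gen hh, by simp [ev]⟩

/-- There is at most one morphism between two expressions generated by the Frobenius structure. -/
theorem FrobLDFunctor.gen_unique {X Y : Tree (Tree K)} {f g}
    (hf : Gen LDd (F.atoms e) (F.Generator e) X Y f)
    (hg : Gen LDd (F.atoms e) (F.Generator e) X Y g) : f = g := by
  have key {f} (hf : Gen LDd (F.atoms e) (F.Generator e) X Y f) : F.TargetNorm e X Y f := by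
    have h : F.TargetNorm e X X (𝟙 _) :=
      .id (fun A => ⟨A, _, _, .atom A, .id .mk A, by simp [ev]⟩) X
    simpa using h.comp_gen F.atomSplit_coassoc F.atomSplit_coassocInv
      (fun _ _ _ hf _ _ hp => FrobLDFunctor.TargetNorm.comp_generator hp hf) hf
  exact (key hf).unique (key hg)

end Target

section GenCat

/-- The category of expressions and generated morphisms. -/
def GenCat (L : LD C) {K : Type w} (e : K → C)
    (_ : ∀ X Y : Tree K, (ev L e X ⟶ ev L e Y) → Prop) : Type w := Tree K

variable {L : LD C} {K : Type w} {e : K → C}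
  {G : ∀ X Y : Tree K, (ev L e X ⟶ ev L e Y) → Prop}

instance : Category (GenCat L e G) where
  Hom X Y := {f : ev L e X ⟶ ev L e Y // Gen L e G X Y f}
  id X := ⟨𝟙 _, .id X⟩
  comp f g := ⟨f.1 ≫ g.1, f.2.comp g.2⟩
  id_comp _ := Subtype.ext (Category.id_comp _)
  comp_id _ := Subtype.ext (Category.comp_id _)
  assoc _ _ _ := Subtype.ext (Category.assoc _ _ _)

/-- The LD structure on the category of expressions. -/
def GenCat.ld (L : LD C) {K : Type w} (e : K → C)
    (G : ∀ X Y : Tree K, (ev L e X ⟶ ev L e Y) → Prop) : LD (GenCat L e G) where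
  ot X Y := Tree.ot X Y
  pa X Y := Tree.pa X Y
  otHom f g := ⟨L.otHom f.1 g.1, f.2.ot g.2⟩
  paHom f g := ⟨L.paHom f.1 g.1, f.2.pa g.2⟩
  otHom_id _ _ := Subtype.ext (L.otHom_id _ _)
  otHom_comp _ _ _ _ := Subtype.ext (L.otHom_comp _ _ _ _)
  paHom_id _ _ := Subtype.ext (L.paHom_id _ _)
  paHom_comp _ _ _ _ := Subtype.ext (L.paHom_comp _ _ _ _)
  α A B E := ⟨L.α _ _ _, .α A B E⟩
  αInv A B E := ⟨L.αInv _ _ _, .αInv A B E⟩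
  pα A B E := ⟨L.pα _ _ _, .pα A B E⟩
  pαInv A B E := ⟨L.pαInv _ _ _, .pαInv A B E⟩
  δl A B E := ⟨L.δl _ _ _, .δl A B E⟩
  δr A B E := ⟨L.δr _ _ _, .δr A B E⟩
  α_αInv _ _ _ := Subtype.ext (L.α_αInv _ _ _)
  αInv_α _ _ _ := Subtype.ext (L.αInv_α _ _ _)
  pα_pαInv _ _ _ := Subtype.ext (L.pα_pαInv _ _ _)
  pαInv_pα _ _ _ := Subtype.ext (L.pαInv_pα _ _ _)
  α_natural _ _ _ := Subtype.ext (L.α_natural _ _ _)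
  pα_natural _ _ _ := Subtype.ext (L.pα_natural _ _ _)
  δl_natural _ _ _ := Subtype.ext (L.δl_natural _ _ _)
  δr_natural _ _ _ := Subtype.ext (L.δr_natural _ _ _)
  P1 _ _ _ _ := Subtype.ext (L.P1 _ _ _ _)
  P2 _ _ _ _ := Subtype.ext (L.P2 _ _ _ _)
  P3 _ _ _ _ := Subtype.ext (L.P3 _ _ _ _)
  P4 _ _ _ _ := Subtype.ext (L.P4 _ _ _ _)
  P5 _ _ _ _ := Subtype.ext (L.P5 _ _ _ _)
  P6 _ _ _ _ := Subtype.ext (L.P6 _ _ _ _)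
  P7 _ _ _ _ := Subtype.ext (L.P7 _ _ _ _)
  P8 _ _ _ _ := Subtype.ext (L.P8 _ _ _ _)

/-- The evaluation of expressions is a strict functor. -/
def GenCat.eval (L : LD C) {K : Type w} (e : K → C)
    (G : ∀ X Y : Tree K, (ev L e X ⟶ ev L e Y) → Prop) :
    StrictLDFunctor (GenCat L e G) C (GenCat.ld L e G) L where
  toFunctor := { obj := fun X => ev L e X, map := fun f => f.1 }
  obj_ot _ _ := rfl
  obj_pa _ _ := rfl
  map_ot _ _ := ((Category.id_comp _).trans (Category.comp_id _)).symm
  map_pa _ _ := ((Category.id_comp _).trans (Category.comp_id _)).symm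
  map_α _ _ _ := ((Category.id_comp _).trans (Category.comp_id _)).symm
  map_αInv _ _ _ := ((Category.id_comp _).trans (Category.comp_id _)).symm
  map_pα _ _ _ := ((Category.id_comp _).trans (Category.comp_id _)).symm
  map_pαInv _ _ _ := ((Category.id_comp _).trans (Category.comp_id _)).symm
  map_δl _ _ _ := ((Category.id_comp _).trans (Category.comp_id _)).symm
  map_δr _ _ _ := ((Category.id_comp _).trans (Category.comp_id _)).symm

/-- The Frobenius LD functor between categories of expressions induced by `F`. -/
def GenCat.frob (F : FrobLDFunctor Cc Dd LC LDd) {K : Type w} (e : K → Cc) :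
    FrobLDFunctor (GenCat LC e fun _ _ _ => False) (GenCat LDd (F.atoms e) (F.Generator e))
      (GenCat.ld LC e _) (GenCat.ld LDd (F.atoms e) _) where
  toFunctor :=
    { obj := fun A => Tree.atom A
      map := fun h => ⟨F.toFunctor.map h.1, .of (.map h.2)⟩
      map_id := fun _ => Subtype.ext (F.toFunctor.map_id _)
      map_comp := fun _ _ => Subtype.ext (F.toFunctor.map_comp _ _) }
  μ A B := ⟨F.μ _ _, .of (.μ A B)⟩
  Δ A B := ⟨F.Δ _ _, .of (.Δ A B)⟩
  μ_natural _ _ := Subtype.ext (F.μ_natural _ _)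
  Δ_natural _ _ := Subtype.ext (F.Δ_natural _ _)
  H1 _ _ _ := Subtype.ext (F.H1 _ _ _)
  H2 _ _ _ := Subtype.ext (F.H2 _ _ _)
  H3 _ _ _ := Subtype.ext (F.H3 _ _ _)
  H4 _ _ _ := Subtype.ext (F.H4 _ _ _)

/-- The identity strict Frobenius LD functor. -/
def StrictLDFunctor.id (L : LD C) : StrictLDFunctor C C L L where
  toFunctor := 𝟭 C
  obj_ot _ _ := rfl
  obj_pa _ _ := rfl
  map_ot _ _ := ((Category.id_comp _).trans (Category.comp_id _)).symm
  map_pa _ _ := ((Category.id_comp _).trans (Category.comp_id _)).symm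
  map_α _ _ _ := ((Category.id_comp _).trans (Category.comp_id _)).symm
  map_αInv _ _ _ := ((Category.id_comp _).trans (Category.comp_id _)).symm
  map_pα _ _ _ := ((Category.id_comp _).trans (Category.comp_id _)).symm
  map_pαInv _ _ _ := ((Category.id_comp _).trans (Category.comp_id _)).symm
  map_δl _ _ _ := ((Category.id_comp _).trans (Category.comp_id _)).symm
  map_δr _ _ _ := ((Category.id_comp _).trans (Category.comp_id _)).symm

/-- The composite of two strict Frobenius LD functors. -/
def StrictLDFunctor.comp (H : StrictLDFunctor C Cc L LC) (I : StrictLDFunctor Cc Dd LC LDd) :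
    StrictLDFunctor C Dd L LDd where
  toFunctor := H.toFunctor ⋙ I.toFunctor
  obj_ot X Y := by simp [H.obj_ot, I.obj_ot]
  obj_pa X Y := by simp [H.obj_pa, I.obj_pa]
  map_ot f g := by simp [H.map_ot, I.map_ot, eqToHom_map]
  map_pa f g := by simp [H.map_pa, I.map_pa, eqToHom_map]
  map_α A B E := by simp [H.map_α, I.map_α, eqToHom_map]
  map_αInv A B E := by simp [H.map_αInv, I.map_αInv, eqToHom_map]
  map_pα A B E := by simp [H.map_pα, I.map_pα, eqToHom_map]
  map_pαInv A B E := by simp [H.map_pαInv, I.map_pαInv, eqToHom_map]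
  map_δl A B E := by simp [H.map_δl, I.map_δl, eqToHom_map]
  map_δr A B E := by simp [H.map_δr, I.map_δr, eqToHom_map]

end GenCat

theorem map_heq_of_heq (I : Cc ⥤ Dd) {X Y X' Y' : Cc} (hX : X = X') (hY : Y = Y')
    {f : X ⟶ Y} {g : X' ⟶ Y'} (h : HEq f g) : HEq (I.map f) (I.map g) := by
  subst hX hY
  cases h
  rfl

/-- **Coherence theorem for Frobenius linearly distributive functors**:
the target category of the free unitless Frobenius LD functor on a set `S` is thin. -/
theorem target_of_free_Frobenius_LD_functor_is_thin
    (S : Type) (Cs Ds : Type) [Category.{0} Cs] [Category.{0} Ds]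
    (LCs : LD Cs) (LDs : LD Ds) (Fs : FrobLDFunctor Cs Ds LCs LDs) (η : S → Cs)
    (hfree : ∀ (E E' : Type) [instE : Category.{0} E] [instE' : Category.{0} E']
        (LE : LD E) (LE' : LD E') (G : FrobLDFunctor E E' LE LE') (f : S → E),
      ∃ (H : StrictLDFunctor Cs E LCs LE) (I : StrictLDFunctor Ds E' LDs LE'),
        (Fs.toFunctor ⋙ I.toFunctor = H.toFunctor ⋙ G.toFunctor) ∧
        (∀ X Y : Cs,
          HEq (I.toFunctor.map (Fs.μ X Y)) (G.μ (H.toFunctor.obj X) (H.toFunctor.obj Y))) ∧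
        (∀ X Y : Cs,
          HEq (I.toFunctor.map (Fs.Δ X Y)) (G.Δ (H.toFunctor.obj X) (H.toFunctor.obj Y))) ∧
        (∀ s : S, H.toFunctor.obj (η s) = f s) ∧
        (∀ (H' : StrictLDFunctor Cs E LCs LE) (I' : StrictLDFunctor Ds E' LDs LE'),
          (Fs.toFunctor ⋙ I'.toFunctor = H'.toFunctor ⋙ G.toFunctor) →
          (∀ X Y : Cs,
            HEq (I'.toFunctor.map (Fs.μ X Y)) (G.μ (H'.toFunctor.obj X) (H'.toFunctor.obj Y))) →
          (∀ X Y : Cs,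
            HEq (I'.toFunctor.map (Fs.Δ X Y)) (G.Δ (H'.toFunctor.obj X) (H'.toFunctor.obj Y))) →
          (∀ s : S, H'.toFunctor.obj (η s) = f s) →
          H'.toFunctor = H.toFunctor ∧ I'.toFunctor = I.toFunctor)) :
    ∀ (X Y : Ds) (g h : X ⟶ Y), g = h := by
  intro X Y g h
  obtain ⟨H, I, hFI, hμ, hΔ, hη, -⟩ := hfree _ _ _ _ (GenCat.frob Fs η) Tree.atom
  obtain ⟨H₀, I₀, -, -, -, -, huniq⟩ := hfree _ _ LCs LDs Fs η
  have hobj (A : Cs) : I.toFunctor.obj (Fs.toFunctor.obj A) =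
      (GenCat.frob Fs η).toFunctor.obj (H.toFunctor.obj A) :=
    Functor.congr_obj hFI A
  have hI : (I.comp (GenCat.eval LDs (Fs.atoms η) (Fs.Generator η))).toFunctor = 𝟭 Ds := by
    refine ((huniq (H.comp (GenCat.eval LCs η fun _ _ _ => False)) _ ?_ ?_ ?_ ?_).2).trans
      (huniq (.id LCs) (.id LDs) rfl (fun _ _ => .rfl) (fun _ _ => .rfl) fun _ => rfl).2.symm
    · exact congrArg (· ⋙ (GenCat.eval LDs (Fs.atoms η) (Fs.Generator η)).toFunctor) hFI
    · intro A B
      refine map_heq_of_heq (GenCat.eval LDs (Fs.atoms η) (Fs.Generator η)).toFunctor ?_ ?_ (hμ A B)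
      · rw [I.obj_ot, hobj, hobj]
      · rw [hobj, H.obj_ot]
    · intro A B
      refine map_heq_of_heq (GenCat.eval LDs (Fs.atoms η) (Fs.Generator η)).toFunctor ?_ ?_ (hΔ A B)
      · rw [hobj, H.obj_pa]
      · rw [I.obj_pa, hobj, hobj]
    · exact fun s => congrArg (ev LCs η) (hη s)
  have hgh : I.toFunctor.map g = I.toFunctor.map h :=
    Subtype.ext (FrobLDFunctor.gen_unique (I.toFunctor.map g).2 (I.toFunctor.map h).2)
  have hfaithful : (I.comp (GenCat.eval LDs (Fs.atoms η) (Fs.Generator η))).toFunctor.Faithful := by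
    rw [hI]; infer_instance
  exact hfaithful.map_injective
    (congrArg (GenCat.eval LDs (Fs.atoms η) (Fs.Generator η)).toFunctor.map hgh)

end LDCoherence
end

section
/- Laplaza's coherence theorem: the free unitless lax monoidal category on any type S is thin. Precisely, let 𝓕 be a unitless lax monoidal category together with a function η : S → Ob(𝓕) satisfying the universal property of the free unitless lax monoidal category on S; then for all objects X, Y of 𝓕 there is at most one morphism X → Y. -/
open CategoryTheory

namespace LaxMonCoherence

universe v u v₁ u₁ v₂ u₂

/-- A unitless lax monoidal category structure on a category `C`: a tensor product together
with a (not necessarily invertible) associator satisfying the pentagon axiom. -/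
structure LaxMon (C : Type u) [Category.{v} C] where
  ot : C → C → C
  otHom : ∀ {X₁ Y₁ X₂ Y₂ : C}, (X₁ ⟶ Y₁) → (X₂ ⟶ Y₂) → (ot X₁ X₂ ⟶ ot Y₁ Y₂)
  otHom_id : ∀ X Y : C, otHom (𝟙 X) (𝟙 Y) = 𝟙 (ot X Y)
  otHom_comp :
    ∀ {X₁ Y₁ Z₁ X₂ Y₂ Z₂ : C} (f₁ : X₁ ⟶ Y₁) (g₁ : Y₁ ⟶ Z₁) (f₂ : X₂ ⟶ Y₂) (g₂ : Y₂ ⟶ Z₂),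
      otHom (f₁ ≫ g₁) (f₂ ≫ g₂) = otHom f₁ f₂ ≫ otHom g₁ g₂
  α : ∀ A B E : C, ot A (ot B E) ⟶ ot (ot A B) E
  α_natural :
    ∀ {A A' B B' E E' : C} (f : A ⟶ A') (g : B ⟶ B') (h : E ⟶ E'),
      otHom f (otHom g h) ≫ α A' B' E' = α A B E ≫ otHom (otHom f g) h
  pentagon : ∀ A B E D : C,
    α A B (ot E D) ≫ α (ot A B) E D =
      otHom (𝟙 A) (α B E D) ≫ α A (ot B E) D ≫ otHom (α A B E) (𝟙 D)

/-- A strict monoidal functor of unitless lax monoidal categories. -/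
structure StrictMonFunctor (Cc : Type u₁) [Category.{v₁} Cc] (Dd : Type u₂) [Category.{v₂} Dd]
    (LC : LaxMon Cc) (LDd : LaxMon Dd) where
  toFunctor : Cc ⥤ Dd
  obj_ot : ∀ X Y : Cc, toFunctor.obj (LC.ot X Y) = LDd.ot (toFunctor.obj X) (toFunctor.obj Y)
  map_ot : ∀ {X₁ Y₁ X₂ Y₂ : Cc} (f : X₁ ⟶ Y₁) (g : X₂ ⟶ Y₂),
    toFunctor.map (LC.otHom f g) =
      eqToHom (obj_ot X₁ X₂) ≫ LDd.otHom (toFunctor.map f) (toFunctor.map g) ≫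
        eqToHom (obj_ot Y₁ Y₂).symm
  map_α : ∀ A B E : Cc,
    toFunctor.map (LC.α A B E) =
      eqToHom (by simp only [obj_ot]) ≫
        LDd.α (toFunctor.obj A) (toFunctor.obj B) (toFunctor.obj E) ≫
        eqToHom (by simp only [obj_ot])

/-- Nonempty binary trees with leaves labelled by `S`. -/
inductive Tree (S : Type) : Type
  | leaf : S → Tree S
  | node : Tree S → Tree S → Tree S

namespace Tree

variable {S : Type}

/-- The number of leaves. -/
def size : Tree S → ℕ
  | leaf _ => 1
  | node A B => A.size + B.size

theorem size_pos : ∀ A : Tree S, 0 < A.size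
  | leaf _ => Nat.one_pos
  | node A _ => Nat.add_pos_left A.size_pos _

/-- Formal morphisms between trees, generated by the associators. -/
inductive Term : Tree S → Tree S → Type
  | id (A : Tree S) : Term A A
  | comp {A B E : Tree S} : Term A B → Term B E → Term A E
  | tensor {A A' B B' : Tree S} : Term A A' → Term B B' → Term (node A B) (node A' B')
  | assoc (A B E : Tree S) : Term (node A (node B E)) (node (node A B) E)

theorem Term.size_eq {A B : Tree S} (t : Term A B) : A.size = B.size := by
  induction t with
  | id => rfl
  | comp _ _ h₁ h₂ => exact h₁.trans h₂
  | tensor _ _ h₁ h₂ => simp only [size, h₁, h₂]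
  | assoc => simp only [size, Nat.add_assoc]

/-- `Split X X₁ X₂` says that cutting `X` at a vertex of its right spine
leaves the pieces `X₁` and `X₂`. -/
inductive Split : Tree S → Tree S → Tree S → Type
  | root (A B : Tree S) : Split (node A B) A B
  | right (A : Tree S) {B B₁ B₂ : Tree S} : Split B B₁ B₂ → Split (node A B) (node A B₁) B₂

/-- A splitting is determined by the size of its left piece. -/
theorem Split.eq_of_size_eq {X X₁ X₂ X₁' X₂' : Tree S} (p : Split X X₁ X₂)
    (q : Split X X₁' X₂') (h : X₁.size = X₁'.size) :
    (⟨X₁, X₂, p⟩ : Σ Y₁ Y₂, Split X Y₁ Y₂) = ⟨X₁', X₂', q⟩ := by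
  induction p generalizing X₁' X₂' with
  | root A B =>
    cases q with
    | root => rfl
    | @right _ _ B₁ _ q =>
      have := B₁.size_pos
      simp only [size] at h
      omega
  | @right A B B₁ B₂ p ih =>
    cases q with
    | root =>
      have := B₁.size_pos
      simp only [size] at h
      omega
    | right _ q =>
      cases ih q (Nat.add_left_cancel h)
      rfl

section Interpretation

variable {C : Type u} [Category.{v} C] (L : LaxMon C) (f : S → C)

/-- The interpretation of trees in a unitless lax monoidal category. -/
def eval : Tree S → C
  | leaf s => f s
  | node A B => L.ot A.eval B.eval

/-- The interpretation of formal morphisms. -/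
def Term.eval : ∀ {A B : Tree S}, Term A B → (A.eval L f ⟶ B.eval L f)
  | _, _, .id A => 𝟙 (A.eval L f)
  | _, _, .comp t u => t.eval ≫ u.eval
  | _, _, .tensor t u => L.otHom t.eval u.eval
  | _, _, .assoc A B E => L.α (A.eval L f) (B.eval L f) (E.eval L f)

/-- The canonical morphism from a tree to the tensor product of its pieces. -/
def Split.eval : ∀ {X X₁ X₂ : Tree S}, Split X X₁ X₂ →
    (X.eval L f ⟶ L.ot (X₁.eval L f) (X₂.eval L f))
  | _, _, _, .root A B => 𝟙 (L.ot (A.eval L f) (B.eval L f))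
  | _, _, _, .right A (B₁ := B₁) (B₂ := B₂) p =>
    L.otHom (𝟙 (A.eval L f)) p.eval ≫ L.α (A.eval L f) (B₁.eval L f) (B₂.eval L f)

/-- Every splitting of the target of a formal morphism pulls back to a splitting of its source. -/
theorem Term.exists_split {X Y Y₁ Y₂ : Tree S} (t : Term X Y) (q : Split Y Y₁ Y₂) :
    ∃ (X₁ X₂ : Tree S) (p : Split X X₁ X₂) (t₁ : Term X₁ Y₁) (t₂ : Term X₂ Y₂),
      t.eval L f ≫ q.eval L f = p.eval L f ≫ L.otHom (t₁.eval L f) (t₂.eval L f) := by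
  induction t generalizing Y₁ Y₂ with
  | id A => exact ⟨_, _, q, .id _, .id _, by simp [Term.eval, L.otHom_id]⟩
  | comp t u iht ihu =>
    obtain ⟨_, _, p, u₁, u₂, hu⟩ := ihu q
    obtain ⟨_, _, r, t₁, t₂, ht⟩ := iht p
    refine ⟨_, _, r, .comp t₁ u₁, .comp t₂ u₂, ?_⟩
    simp only [Term.eval, Category.assoc, hu, L.otHom_comp]
    rw [← Category.assoc, ht, Category.assoc]
  | @tensor A A' B B' t u iht ihu =>
    cases q with
    | root => exact ⟨_, _, .root _ _, t, u, by
        simp only [Term.eval, Split.eval]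
        exact (Category.comp_id _).trans (Category.id_comp _).symm⟩
    | right _ q =>
      obtain ⟨_, _, p, u₁, u₂, hu⟩ := ihu q
      refine ⟨_, _, .right _ p, .tensor t u₁, u₂, ?_⟩
      calc
        _ = (L.otHom (t.eval L f) (u.eval L f) ≫ L.otHom (𝟙 _) (q.eval L f)) ≫ L.α _ _ _ :=
          (Category.assoc _ _ _).symm
        _ = L.otHom (𝟙 _) (p.eval L f) ≫
            L.otHom (t.eval L f) (L.otHom (u₁.eval L f) (u₂.eval L f)) ≫ L.α _ _ _ := by
          rw [← L.otHom_comp, hu, ← Category.assoc, ← L.otHom_comp, Category.comp_id,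
            Category.id_comp]
        _ = (L.otHom (𝟙 _) (p.eval L f) ≫ L.α _ _ _) ≫
            L.otHom (L.otHom (t.eval L f) (u₁.eval L f)) (u₂.eval L f) := by
          rw [L.α_natural, Category.assoc]
  | assoc A B E =>
    cases q with
    | root =>
      refine ⟨_, _, .right _ (.root _ _), .id _, .id _, ?_⟩
      simp only [Term.eval, Split.eval, L.otHom_id]
      erw [Category.comp_id, L.otHom_id, Category.id_comp, Category.comp_id]
    | @right _ _ E₁ _ q =>
      refine ⟨_, _, .right _ (.right _ q), .assoc _ _ _, .id _, ?_⟩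
      have hid : L.otHom (L.otHom (𝟙 (A.eval L f)) (𝟙 (B.eval L f))) (q.eval L f) =
          L.otHom (𝟙 _) (q.eval L f) := by rw [L.otHom_id]
      have hsplit := L.otHom_comp (𝟙 (A.eval L f)) (𝟙 _)
        (L.otHom (𝟙 (B.eval L f)) (q.eval L f)) (L.α _ _ _)
      have hnat := L.α_natural (𝟙 (A.eval L f)) (𝟙 (B.eval L f)) (q.eval L f)
      have hpent := L.pentagon (A.eval L f) (B.eval L f) (E₁.eval L f) (Y₂.eval L f)
      simp only [Category.comp_id] at hsplit
      calc
        _ = (L.α _ _ _ ≫ L.otHom (𝟙 (L.ot (A.eval L f) (B.eval L f))) (q.eval L f)) ≫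
            L.α _ _ _ := (Category.assoc _ _ _).symm
        _ = L.otHom (𝟙 _) (L.otHom (𝟙 _) (q.eval L f)) ≫ L.α _ _ _ ≫ L.α _ _ _ := by
          rw [← hid, ← hnat, Category.assoc]
        _ = (L.otHom (𝟙 _) (L.otHom (𝟙 _) (q.eval L f) ≫ L.α _ _ _) ≫ L.α _ _ _) ≫
            L.otHom (L.α _ _ _) (𝟙 _) := by
          rw [hpent, hsplit]
          simp only [Category.assoc]

/-- Formal morphisms into a leaf are interpreted as identities. -/
theorem Term.eval_eq_eqToHom {X Y : Tree S} (t : Term X Y) {s : S} (hY : Y = leaf s) :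
    ∃ h : X = Y, t.eval L f = eqToHom (congrArg (Tree.eval L f) h) := by
  induction t with
  | id => exact ⟨rfl, rfl⟩
  | comp t u iht ihu =>
    obtain ⟨rfl, hu⟩ := ihu hY
    obtain ⟨rfl, ht⟩ := iht hY
    exact ⟨rfl, by simp [Term.eval, hu, ht]⟩
  | tensor => cases hY
  | assoc => cases hY

/-- Parallel formal morphisms have equal interpretations. -/
theorem Term.eval_eq {X Y : Tree S} (t u : Term X Y) : t.eval L f = u.eval L f := by
  induction Y generalizing X with
  | leaf s =>
    obtain ⟨_, ht⟩ := t.eval_eq_eqToHom L f rfl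
    obtain ⟨_, hu⟩ := u.eval_eq_eqToHom L f rfl
    rw [ht, hu]
  | node Y₁ Y₂ ih₁ ih₂ =>
    obtain ⟨_, _, p, t₁, t₂, ht⟩ := t.exists_split L f (.root _ _)
    obtain ⟨_, _, q, u₁, u₂, hu⟩ := u.exists_split L f (.root _ _)
    cases p.eq_of_size_eq q (t₁.size_eq.trans u₁.size_eq.symm)
    rw [ih₁ t₁ u₁, ih₂ t₂ u₂, ← hu] at ht
    exact (Category.comp_id _).symm.trans (ht.trans (Category.comp_id _))

end Interpretation

/-- The (labelled) Tamari preorder. -/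
instance : Preorder (Tree S) where
  le A B := Nonempty (Term A B)
  le_refl A := ⟨.id A⟩
  le_trans _ _ _ := fun ⟨t⟩ ⟨u⟩ => ⟨.comp t u⟩

/-- The unitless lax monoidal structure on the Tamari preorder. -/
def laxMon : LaxMon (Tree S) where
  ot := node
  otHom g h := homOfLE (g.le.elim fun t => h.le.elim fun u => ⟨.tensor t u⟩)
  otHom_id _ _ := Subsingleton.elim _ _
  otHom_comp _ _ _ _ := Subsingleton.elim _ _
  α A B E := homOfLE ⟨.assoc A B E⟩
  α_natural _ _ _ := Subsingleton.elim _ _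
  pentagon _ _ _ _ := Subsingleton.elim _ _

/-- A formal morphism representing an inequality of trees. -/
noncomputable def termOfHom {A B : Tree S} (g : A ⟶ B) : Term A B :=
  Classical.choice g.le

/-- The interpretation of trees as a strict monoidal functor. -/
noncomputable def evalFunctor {C : Type u} [Category.{v} C] (L : LaxMon C) (f : S → C) :
    StrictMonFunctor (Tree S) C laxMon L where
  toFunctor :=
    { obj := eval L f
      map := fun g => (termOfHom g).eval L f
      map_id := fun X => Term.eval_eq L f _ (.id X)
      map_comp := fun g h => Term.eval_eq L f _ (.comp (termOfHom g) (termOfHom h)) }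
  obj_ot _ _ := rfl
  map_ot g h := by
    erw [eqToHom_refl, eqToHom_refl, Category.id_comp, Category.comp_id]
    exact Term.eval_eq L f _ (.tensor (termOfHom g) (termOfHom h))
  map_α A B E := by
    erw [eqToHom_refl, eqToHom_refl, Category.id_comp, Category.comp_id]
    exact Term.eval_eq L f _ (.assoc A B E)

end Tree

namespace StrictMonFunctor

/-- The identity strict monoidal functor. -/
def id {C : Type u} [Category.{v} C] (L : LaxMon C) : StrictMonFunctor C C L L where
  toFunctor := 𝟭 C
  obj_ot _ _ := rfl
  map_ot _ _ := by simp
  map_α _ _ _ := by simp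

/-- Strict monoidal functors compose. -/
def comp {C : Type u} [Category.{v} C] {D : Type u₁} [Category.{v₁} D]
    {E : Type u₂} [Category.{v₂} E] {LC : LaxMon C} {LD : LaxMon D} {LE : LaxMon E}
    (G : StrictMonFunctor C D LC LD) (H : StrictMonFunctor D E LD LE) :
    StrictMonFunctor C E LC LE where
  toFunctor := G.toFunctor ⋙ H.toFunctor
  obj_ot _ _ := by simp only [Functor.comp_obj, G.obj_ot, H.obj_ot]
  map_ot _ _ := by simp [G.map_ot, H.map_ot, eqToHom_map]
  map_α _ _ _ := by simp [G.map_α, H.map_α, eqToHom_map]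

end StrictMonFunctor

/-- **Laplaza's coherence theorem**: the free unitless lax monoidal category on a set `S`
is thin. -/
theorem free_unitless_lax_monoidal_category_is_thin
    (S : Type) (F : Type) [Category.{0} F] (LF : LaxMon F) (η : S → F)
    (hfree : ∀ (E : Type) [instE : Category.{0} E] (LE : LaxMon E) (f : S → E),
      ∃ G : StrictMonFunctor F E LF LE,
        (∀ s : S, G.toFunctor.obj (η s) = f s) ∧
        ∀ G' : StrictMonFunctor F E LF LE,
          (∀ s : S, G'.toFunctor.obj (η s) = f s) → G'.toFunctor = G.toFunctor) :
    ∀ (X Y : F) (g h : X ⟶ Y), g = h := by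
  intro X Y g h
  obtain ⟨G, hG, -⟩ := hfree (Tree S) Tree.laxMon Tree.leaf
  obtain ⟨K, -, hK⟩ := hfree F LF η
  have hcomp := hK (G.comp (Tree.evalFunctor LF η)) fun s =>
    congrArg (Tree.eval LF η) (hG s)
  have hid : 𝟭 F = G.toFunctor ⋙ (Tree.evalFunctor LF η).toFunctor :=
    (hK (.id LF) fun _ => rfl).trans hcomp.symm
  have hg := Functor.congr_hom hid g
  have hh := Functor.congr_hom hid h
  rw [Functor.comp_map, Subsingleton.elim (G.toFunctor.map g) (G.toFunctor.map h)] at hg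
  exact hg.trans hh.symm

end LaxMonCoherence
end
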